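/- arXiv:1808.04141 — 3 statements merged into one kernel-verified Lean document; each statement's English description precedes it below -/
import Mathlib

section
/- For all positive integers n and r, the colored derangement polynomial d_{n,r} satisfies I_n(d_{n,r}) ≺ d_{n,r}. In particular, d_{n,r} is real-rooted and alternatingly increasing. -/
open Polynomial
open scoped Classical

noncomputable section

/-- The complexification of a real polynomial. -/
def toC (p : ℝ[X]) : ℂ[X] := p.map (algebraMap ℝ ℂ)

/-- A complex polynomial is *stable* if it is identically zero or has no zero with
positive imaginary part. -/
def StableC (f : ℂ[X]) : Prop := f = 0 ∨ ∀ z : ℂ, 0 < z.im → f.eval z ≠ 0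

/-- `Interlaces p q` means `p ≺ q`, i.e. `q + i·p` is stable. -/
def Interlaces (p q : ℝ[X]) : Prop :=
  StableC (toC q + Polynomial.C Complex.I * toC p)

/-- A real polynomial is real-rooted if it is identically zero or all of its complex
zeros are real. -/
def RealRooted (p : ℝ[X]) : Prop :=
  p = 0 ∨ ∀ z : ℂ, (toC p).eval z = 0 → z.im = 0

/-- `Rflip d p = (-1)^d · p(-1-x)`. -/
def Rflip (d : ℕ) (p : ℝ[X]) : ℝ[X] := (-1 : ℝ) ^ d • p.comp (-1 - X)

/-- The f-polynomial of `h` with respect to `d`: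
`f(h;x) = Σ_{k=0}^d h_k x^k (1+x)^{d-k} = (1+x)^d h(x/(1+x))`. -/
def fPoly (d : ℕ) (h : ℝ[X]) : ℝ[X] :=
  ∑ k ∈ Finset.range (d + 1), Polynomial.C (h.coeff k) * X ^ k * (1 + X) ^ (d - k)

/-- The subdivision operator `E`, the unique linear map with `E(binom(x,k)) = x^k`;
here computed via Newton's forward-difference formula
`p = Σ_k (Δ^k p)(0) binom(x,k)` where `Δq = q(x+1) - q(x)`. -/
def subdivE (p : ℝ[X]) : ℝ[X] :=
  ∑ k ∈ Finset.range (p.natDegree + 1),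
    Polynomial.C (((fun q : ℝ[X] => q.comp (X + 1) - q)^[k] p).eval 0) * X ^ k

/-- `Ekd d k = E_k^d = E(x^k (x+1)^(d-k))`. -/
def Ekd (d k : ℕ) : ℝ[X] := subdivE (X ^ k * (X + 1) ^ (d - k))

/-- The cone `𝓔_d` of nonnegative combinations of the `E_k^d`, `0 ≤ k ≤ d`. -/
def coneE (d : ℕ) : Set ℝ[X] :=
  { p | ∃ c : ℕ → ℝ, (∀ i, 0 ≤ c i) ∧ p = ∑ i ∈ Finset.range (d + 1), c i • Ekd d i }

/-- `𝓐_d = {p ∈ 𝓔_d : R_d(p) ≺ p}`. -/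
def Ad (d : ℕ) : Set ℝ[X] := { p | p ∈ coneE d ∧ Interlaces (Rflip d p) p }

/-- `p` is alternatingly increasing with respect to `n`:
`0 ≤ p_0 ≤ p_n ≤ p_1 ≤ p_{n-1} ≤ ⋯ ≤ p_{⌊(n+1)/2⌋}`. -/
def AltInc (n : ℕ) (p : ℝ[X]) : Prop :=
  0 ≤ p.coeff 0 ∧ (∀ k, 2 * k ≤ n → p.coeff k ≤ p.coeff (n - k)) ∧
    (∀ k, 2 * k + 1 ≤ n → p.coeff (n - k) ≤ p.coeff (k + 1))

/-- The number of excedances of an `r`-colored permutation `(σ, z)`: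
indices `k` with `σ k > k`, or `σ k = k` and `z k > 0`. -/
def excC {n r : ℕ} (σ : Equiv.Perm (Fin n)) (z : Fin n → Fin r) : ℕ :=
  (Finset.univ.filter fun k : Fin n => k < σ k ∨ (σ k = k ∧ 0 < (z k : ℕ))).card

/-- The colored Eulerian polynomial `A_{n,r}`. -/
def coloredEulerian (n r : ℕ) : ℝ[X] :=
  ∑ σ : Equiv.Perm (Fin n), ∑ z : Fin n → Fin r, X ^ excC σ z

/-- The colored derangement polynomial `d_{n,r}`: the sum of `x^{exc(σ,z)}` over
colored permutations with no fixed point of color `0`. -/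
def coloredDerangement (n r : ℕ) : ℝ[X] :=
  ∑ σ : Equiv.Perm (Fin n),
    ∑ z ∈ Finset.univ.filter (fun z : Fin n → Fin r => ∀ k, ¬(σ k = k ∧ (z k : ℕ) = 0)),
      X ^ excC σ z

/-- The number of excedances of a permutation. -/
def excP {n : ℕ} (σ : Equiv.Perm (Fin n)) : ℕ :=
  (Finset.univ.filter fun k : Fin n => k < σ k).card

/-- The Eulerian polynomial `A_n`. -/
def eulerianPoly (n : ℕ) : ℝ[X] := ∑ σ : Equiv.Perm (Fin n), X ^ excP σ

/-- The derangement polynomial `d_n`. -/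
def derangePoly (n : ℕ) : ℝ[X] :=
  ∑ σ ∈ Finset.univ.filter (fun σ : Equiv.Perm (Fin n) => ∀ k, σ k ≠ k), X ^ excP σ

/-- The linear map `D` with `D(x^k) = d_k`. -/
def Dmap (p : ℝ[X]) : ℝ[X] :=
  ∑ k ∈ Finset.range (p.natDegree + 1), p.coeff k • derangePoly k

/-- Stability for multivariate complex polynomials: identically zero or nonvanishing
whenever all coordinates have positive imaginary part. -/
def MvStable {n : ℕ} (P : MvPolynomial (Fin n) ℂ) : Prop :=
  P = 0 ∨ ∀ z : Fin n → ℂ, (∀ j, 0 < (z j).im) → MvPolynomial.eval z P ≠ 0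

/-- The operator `T_k(f)(x) = Σ_{i=0}^k (-1)^{k-i} binom(k,i) f((i+1)x)`. -/
def Tk (k : ℕ) (f : ℝ[X]) : ℝ[X] :=
  ∑ i ∈ Finset.range (k + 1),
    ((-1 : ℝ) ^ (k - i) * (k.choose i : ℝ)) • f.comp (Polynomial.C ((i : ℝ) + 1) * X)

/-- The cone `B_{d,γ}` of nonnegative combinations of the polynomials
`x^i (x+1)^{d-i} + x^j (x+1)^{d-j}` with `i + j ≥ γ`. -/
def coneBsum (d γ : ℕ) : Set ℝ[X] :=
  { p | ∃ c : ℕ × ℕ → ℝ, (∀ ij, 0 ≤ c ij) ∧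
      p = ∑ ij ∈ (Finset.range (d + 1) ×ˢ Finset.range (d + 1)).filter
            (fun ij => γ ≤ ij.1 + ij.2),
          c ij • (X ^ ij.1 * (X + 1) ^ (d - ij.1) + X ^ ij.2 * (X + 1) ^ (d - ij.2)) }

/-- The cone `B_{d,m}` of nonnegative combinations of the polynomials
`x^j (mx+1)^{d-j}`, `0 ≤ j ≤ d`. -/
def coneBm (d m : ℕ) : Set ℝ[X] :=
  { p | ∃ c : ℕ → ℝ, (∀ j, 0 ≤ c j) ∧
      p = ∑ j ∈ Finset.range (d + 1), c j • (X ^ j * (Polynomial.C (m : ℝ) * X + 1) ^ (d - j)) }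

end

/-! ### Combinatorial part: the recurrence -/

/-- Weight of an arc `i → j`. -/
noncomputable def wt (a : ℝ) {n : ℕ} (i j : Fin n) : ℝ[X] :=
  if i < j then X else if i = j then C a * X else 1

/-- The normalised colored derangement polynomial. -/
noncomputable def pC (a : ℝ) (n : ℕ) : ℝ[X] :=
  ∑ σ : Equiv.Perm (Fin n), ∏ k, wt a k (σ k)

lemma wt_eq_aux (r : ℕ) (hr : 1 ≤ r) {n : ℕ} (i j : Fin n) :
    ∑ c ∈ Finset.univ.filter (fun c : Fin r => ¬ (j = i ∧ (c : ℕ) = 0)),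
      (if i < j ∨ (j = i ∧ 0 < (c : ℕ)) then (X : ℝ[X]) else 1)
      = C (r : ℝ) * wt (((r : ℝ) - 1) / r) i j := by
  have hr0 : (r : ℝ) ≠ 0 := by positivity
  rcases lt_trichotomy i j with h | h | h
  · have h1 : j ≠ i := h.ne'
    simp [wt, h, h1]
  · subst h
    have h2 : ∀ c ∈ Finset.univ.filter (fun c : Fin r => ¬ (i = i ∧ (c : ℕ) = 0)),
      (if i < i ∨ (i = i ∧ 0 < (c : ℕ)) then (X : ℝ[X]) else 1) = X := by
      intro c hc
      simp at hc
      simp [Nat.pos_of_ne_zero hc]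
    rw [Finset.sum_congr rfl h2]
    obtain ⟨s, rfl⟩ : ∃ s, r = s + 1 := ⟨r - 1, by omega⟩
    have h3 : (Finset.univ.filter (fun c : Fin (s + 1) => ¬ (i = i ∧ (c : ℕ) = 0))).card = s := by
      have : (Finset.univ.filter (fun c : Fin (s + 1) => ¬ (i = i ∧ (c : ℕ) = 0)))
          = Finset.univ.erase 0 := by
        ext c
        rw [Finset.mem_filter, Finset.mem_erase, ne_eq, Fin.ext_iff]
        simp
      rw [this, Finset.card_erase_of_mem (Finset.mem_univ _)]
      simp
    rw [Finset.sum_const, h3]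
    simp only [wt, lt_irrefl, if_false, if_true]
    rw [← mul_assoc, ← C_mul, mul_div_cancel₀ _ hr0]
    simp
  · have h1 : j ≠ i := h.ne
    have h2 : ¬ i < j := not_lt.mpr h.le
    simp [wt, h1, h1.symm, h2]

lemma coloredDerangement_eq (n r : ℕ) (hr : 1 ≤ r) :
    coloredDerangement n r = C ((r : ℝ) ^ n) * pC (((r : ℝ) - 1) / r) n := by
  unfold coloredDerangement pC
  rw [Finset.mul_sum]
  refine Finset.sum_congr rfl fun σ _ => ?_
  have h1 : (Finset.univ.filter (fun z : Fin n → Fin r => ∀ k, ¬(σ k = k ∧ (z k : ℕ) = 0)))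
      = Fintype.piFinset (fun k => Finset.univ.filter
          (fun c : Fin r => ¬ (σ k = k ∧ (c : ℕ) = 0))) := by
    ext z
    simp [Fintype.mem_piFinset]
  have h2 : ∀ z : Fin n → Fin r, (X : ℝ[X]) ^ excC σ z =
      ∏ k, (if k < σ k ∨ (σ k = k ∧ 0 < (z k : ℕ)) then (X : ℝ[X]) else 1) := by
    intro z
    rw [Finset.prod_ite, Finset.prod_const, Finset.prod_const_one, mul_one, excC]
  simp_rw [h2]
  rw [h1, ← Finset.prod_univ_sum (fun k => Finset.univ.filter
          (fun c : Fin r => ¬ (σ k = k ∧ (c : ℕ) = 0)))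
     (fun k c => (if k < σ k ∨ (σ k = k ∧ 0 < (c : ℕ)) then (X : ℝ[X]) else 1))]
  simp_rw [wt_eq_aux r hr]
  rw [Finset.prod_mul_distrib, Finset.prod_const]
  simp

/-- product over all arcs but one. -/
noncomputable def wtE (a : ℝ) {n : ℕ} (σ : Equiv.Perm (Fin n)) (i : Fin n) : ℝ[X] :=
  ∏ k ∈ Finset.univ.erase i, wt a k (σ k)

lemma wt_succ (a : ℝ) {n : ℕ} (i j : Fin n) : wt a i.succ j.succ = wt a i j := by
  simp [wt]

lemma wt_succAbove (a : ℝ) {n : ℕ} (p : Fin (n + 1)) (i j : Fin n) :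
    wt a (p.succAbove i) (p.succAbove j) = wt a i j := by
  simp [wt, Fin.succAbove_lt_succAbove_iff]

lemma pC_insert (a : ℝ) (n : ℕ) :
    pC a (n + 1) = C a * X * pC a n + X * ∑ σ : Equiv.Perm (Fin n), ∑ i, wtE a σ i := by
  unfold pC
  rw [← Equiv.sum_comp Equiv.Perm.decomposeFin.symm, Fintype.sum_prod_type, Fin.sum_univ_succ]
  congr 1
  · rw [Finset.mul_sum]
    refine Finset.sum_congr rfl fun σ _ => ?_
    rw [Fin.prod_univ_succ]
    congr 1
    simp [wt]
  · rw [Finset.sum_comm, Finset.mul_sum]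
    refine Finset.sum_congr rfl fun σ _ => ?_
    rw [← Equiv.sum_comp σ, Finset.mul_sum]
    refine Finset.sum_congr rfl fun i _ => ?_
    rw [Fin.prod_univ_succ]
    have hw0 : wt a 0 (Equiv.Perm.decomposeFin.symm ((σ i).succ, σ) 0) = X := by
      rw [Equiv.Perm.decomposeFin_symm_apply_zero]
      simp [wt]
    rw [hw0]
    congr 1
    · rw [wtE, ← Finset.mul_prod_erase _ _ (Finset.mem_univ i)]
      rw [Equiv.Perm.decomposeFin_symm_apply_succ]
      rw [Equiv.swap_apply_right]
      have : wt a i.succ 0 = 1 := by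
        simp [wt]
      rw [this, one_mul]
      refine Finset.prod_congr rfl fun k hk => ?_
      rw [Equiv.Perm.decomposeFin_symm_apply_succ, Equiv.swap_apply_of_ne_of_ne, wt_succ]
      · exact Fin.succ_ne_zero _
      · intro h
        have := σ.injective (Fin.succ_injective _ h)
        simp [this] at hk

lemma sum_fixed (a : ℝ) (n : ℕ) (i : Fin (n + 1)) :
    ∑ σ ∈ Finset.univ.filter (fun σ : Equiv.Perm (Fin (n + 1)) => σ i = i), wtE a σ i
      = pC a n := by
  unfold pC
  symm
  have key : ∀ (τ : Equiv.Perm (Fin n)) (k : Fin n),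
      τ.extendDomain (finSuccAboveEquiv i) (i.succAbove k) = i.succAbove (τ k) := by
    intro τ k
    have := Equiv.Perm.extendDomain_apply_image τ (finSuccAboveEquiv i) k
    simpa [finSuccAboveEquiv_apply] using this
  have key0 : ∀ (τ : Equiv.Perm (Fin n)), τ.extendDomain (finSuccAboveEquiv i) i = i := by
    intro τ
    exact Equiv.Perm.extendDomain_apply_not_subtype τ _ (by simp)
  refine Finset.sum_bij (fun τ _ => τ.extendDomain (finSuccAboveEquiv i)) ?_ ?_ ?_ ?_
  · intro τ _
    simp [key0]
  · intro τ _ τ' _ h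
    ext k
    have h1 := congrArg (fun e : Equiv.Perm (Fin (n+1)) => e (i.succAbove k)) h
    simp only [key] at h1
    exact congrArg Fin.val (Fin.succAbove_right_injective h1)
  · intro σ hσ
    simp at hσ
    have hp : ∀ x, x ≠ i ↔ σ x ≠ i := by
      intro x
      constructor
      · intro h h'
        exact h (σ.injective (h'.trans hσ.symm))
      · rintro h rfl
        exact h hσ
    refine ⟨(finSuccAboveEquiv i).symm.permCongr (σ.subtypePerm (p := fun x => x ≠ i)
      (fun x => (hp x).symm)), Finset.mem_univ _, ?_⟩
    ext x
    rcases Fin.eq_self_or_eq_succAbove i x with rfl | ⟨k, rfl⟩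
    · rw [key0, hσ]
    · rw [key]
      congr 1
      have := congrArg Subtype.val (finSuccAboveEquiv_apply i ((finSuccAboveEquiv i).symm.permCongr (σ.subtypePerm (p := fun x => x ≠ i)
      (fun x => (hp x).symm)) k))
      simp only at this
      rw [← this]
      simp [Equiv.permCongr_apply, finSuccAboveEquiv_apply]
  · intro τ _
    rw [wtE]
    have : (Finset.univ.erase i : Finset (Fin (n+1))) = Finset.univ.map i.succAboveEmb := by
      ext x
      simp only [Finset.mem_erase, Finset.mem_univ, and_true, Finset.mem_map, true_and]
      constructor
      · intro h
        obtain ⟨k, hk⟩ := Fin.exists_succAbove_eq h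
        exact ⟨k, hk⟩
      · rintro ⟨k, rfl⟩
        exact Fin.succAbove_ne i k
    rw [this, Finset.prod_map]
    refine Finset.prod_congr rfl fun k _ => ?_
    simp only [Fin.succAboveEmb_apply]
    rw [key, wt_succAbove]

lemma wt_deriv (a : ℝ) {n : ℕ} (i j : Fin n) :
    (1 : ℝ[X]) = wt a i j + (1 - X) * derivative (wt a i j)
      + if j = i then C (1 - a) else 0 := by
  unfold wt
  rcases lt_trichotomy i j with h | h | h
  · simp [h, h.ne']
  · subst h
    simp
    ring
  · simp [h.ne, h.ne', not_lt.mpr h.le]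

lemma pC_rec (a : ℝ) (n : ℕ) :
    pC a (n + 2) = (C a + ((n : ℝ[X]) + 1)) * X * pC a (n + 1)
      + X * (1 - X) * derivative (pC a (n + 1)) + C (1 - a) * ((n : ℝ[X]) + 1) * X * pC a n := by
  rw [pC_insert]
  have h1 : ∑ σ : Equiv.Perm (Fin (n + 1)), ∑ i, wtE a σ i =
      ((n : ℝ[X]) + 1) * pC a (n + 1) + (1 - X) * derivative (pC a (n + 1))
      + C (1 - a) * ∑ σ : Equiv.Perm (Fin (n + 1)), ∑ i, (if σ i = i then wtE a σ i else 0) := by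
    unfold pC
    rw [derivative_sum, Finset.mul_sum, Finset.mul_sum, Finset.mul_sum,
      ← Finset.sum_add_distrib, ← Finset.sum_add_distrib]
    refine Finset.sum_congr rfl fun σ _ => ?_
    have h2 : ((n : ℝ[X]) + 1) * ∏ k, wt a k (σ k) = ∑ i : Fin (n + 1), wt a i (σ i) * wtE a σ i := by
      have : ∀ i : Fin (n + 1), wt a i (σ i) * wtE a σ i = ∏ k, wt a k (σ k) := by
        intro i
        exact Finset.mul_prod_erase _ (fun k => wt a k (σ k)) (Finset.mem_univ i)
      simp [this]
    rw [h2, derivative_prod_finset, Finset.mul_sum, Finset.mul_sum, ← Finset.sum_add_distrib,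
      ← Finset.sum_add_distrib]
    refine Finset.sum_congr rfl fun i _ => ?_
    have h3 : (∏ k ∈ Finset.univ.erase i, wt a k (σ k)) = wtE a σ i := rfl
    rw [h3]
    have h4 := wt_deriv a i (σ i)
    calc wtE a σ i = 1 * wtE a σ i := by ring
      _ = _ := by
        rw [congrArg (fun t => t * wtE a σ i) h4]
        split_ifs <;> ring
  have h5 : ∑ σ : Equiv.Perm (Fin (n + 1)), ∑ i, (if σ i = i then wtE a σ i else 0)
      = ((n : ℝ[X]) + 1) * pC a n := by
    rw [Finset.sum_comm]
    simp_rw [← Finset.sum_filter, sum_fixed]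
    simp
  rw [h1, h5]
  ring

lemma pC_zero (a : ℝ) : pC a 0 = 1 := by
  simp [pC]

lemma pC_one (a : ℝ) : pC a 1 = C a * X := by
  simp [pC, wt]

/-! ### The symmetric decomposition -/

/-- The pair `(A_n, B_n)` with `p_n = A_n + a x B_n`. -/
noncomputable def AB (a : ℝ) : ℕ → ℝ[X] × ℝ[X]
  | 0 => (1, 0)
  | 1 => (0, 1)
  | n + 2 =>
    (X * (C ((n : ℝ) + 1) * (AB a (n + 1)).1 + (1 - X) * derivative (AB a (n + 1)).1
        + C (a * (1 - a)) * (AB a (n + 1)).2 + C ((1 - a) * ((n : ℝ) + 1)) * (AB a n).1),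
     (AB a (n + 1)).1 + C a * (1 + X) * (AB a (n + 1)).2
        + X * (C (n : ℝ) * (AB a (n + 1)).2 + (1 - X) * derivative (AB a (n + 1)).2
        + C ((1 - a) * ((n : ℝ) + 1)) * (AB a n).2))

lemma A_rec (a : ℝ) (n : ℕ) : (AB a (n + 2)).1 =
    X * (C ((n : ℝ) + 1) * (AB a (n + 1)).1 + (1 - X) * derivative (AB a (n + 1)).1
        + C (a * (1 - a)) * (AB a (n + 1)).2 + C ((1 - a) * ((n : ℝ) + 1)) * (AB a n).1) := by
  simp only [AB]

lemma B_rec (a : ℝ) (n : ℕ) : (AB a (n + 2)).2 =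
    (AB a (n + 1)).1 + C a * (1 + X) * (AB a (n + 1)).2
        + X * (C (n : ℝ) * (AB a (n + 1)).2 + (1 - X) * derivative (AB a (n + 1)).2
        + C ((1 - a) * ((n : ℝ) + 1)) * (AB a n).2) := by
  simp only [AB]

lemma pC_eq_AB (a : ℝ) (n : ℕ) : pC a n = (AB a n).1 + C a * X * (AB a n).2 := by
  induction n using Nat.twoStepInduction with
  | zero => simp [pC_zero, AB]
  | one => simp [pC_one, AB]
  | more n h0 h1 =>
    rw [pC_rec, h0, h1, A_rec, B_rec]
    simp only [derivative_add, derivative_mul, derivative_C, derivative_X, C_add, C_mul, C_sub,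
      C_1, map_natCast]
    ring

/-- gamma-nonnegative polynomials with centre of symmetry `m/2`. -/
inductive Gam : ℕ → ℝ[X] → Prop
  | zero (m : ℕ) : Gam m 0
  | add (m : ℕ) (f g : ℝ[X]) : Gam m f → Gam m g → Gam m (f + g)
  | mono (c : ℝ) (hc : 0 ≤ c) (i j m : ℕ) (hm : m = 2 * i + j) :
      Gam m (C c * X ^ i * (1 + X) ^ j)

lemma Gam.smul {m : ℕ} {f : ℝ[X]} (h : Gam m f) {d : ℝ} (hd : 0 ≤ d) : Gam m (C d * f) := by
  induction h with
  | zero m => simpa using Gam.zero m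
  | add m f g _ _ hf hg => rw [mul_add]; exact Gam.add _ _ _ hf hg
  | mono c hc i j m hm =>
    have := Gam.mono (d * c) (by positivity) i j m hm
    rwa [C_mul, mul_assoc, mul_assoc, ← mul_assoc (C c)] at this

lemma Gam.mulX {m : ℕ} {f : ℝ[X]} (h : Gam m f) : Gam (m + 2) (X * f) := by
  induction h with
  | zero m => simpa using Gam.zero _
  | add m f g _ _ hf hg => rw [mul_add]; exact Gam.add _ _ _ hf hg
  | mono c hc i j m hm =>
    have := Gam.mono c hc (i + 1) j (m + 2) (by omega)
    convert this using 1
    ring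

lemma Gam.mul1X {m : ℕ} {f : ℝ[X]} (h : Gam m f) : Gam (m + 1) ((1 + X) * f) := by
  induction h with
  | zero m => simpa using Gam.zero _
  | add m f g _ _ hf hg => rw [mul_add]; exact Gam.add _ _ _ hf hg
  | mono c hc i j m hm =>
    have := Gam.mono c hc i (j + 1) (m + 1) (by omega)
    convert this using 1
    ring

lemma Gam.T {m : ℕ} {f : ℝ[X]} (h : Gam m f) :
    Gam (m + 1) (X * (C (m : ℝ) * f + (1 - X) * derivative f)) := by
  induction h with
  | zero m => simpa using Gam.zero _
  | add m f g _ _ hf hg =>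
    have := Gam.add _ _ _ hf hg
    convert this using 1
    rw [derivative_add]
    ring
  | mono c hc i j m hm =>
    have e1 := Gam.mono (c * i) (by positivity) i (j + 1) (m + 1) (by omega)
    have e2 : Gam (m + 1) (C (c * (2 * j)) * X ^ (i + 1) * (1 + X) ^ (j - 1)) := by
      rcases j with _ | j
      · simpa using Gam.zero _
      · exact Gam.mono (c * (2 * ((j + 1 : ℕ) : ℝ))) (by positivity) (i + 1) j (m + 1) (by omega)
    have := Gam.add _ _ _ e1 e2
    convert this using 1
    subst hm
    rcases i with _ | i <;> rcases j with _ | j <;>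
    · simp only [derivative_mul, derivative_C, derivative_pow, derivative_add,
        derivative_one, derivative_X, C_mul, Nat.cast_add, Nat.cast_mul, C_add, map_natCast,
        Nat.cast_one, Nat.cast_zero, C_0, C_1, Nat.cast_ofNat, Nat.add_sub_cancel, map_ofNat]
      ring

lemma Gam_AB (a : ℝ) (ha : 0 ≤ a) (ha1 : a ≤ 1) (n : ℕ) :
    Gam n (AB a n).1 ∧ Gam (n - 1) (AB a n).2 := by
  have hb : 0 ≤ 1 - a := by linarith
  induction n using Nat.twoStepInduction with
  | zero =>
    refine ⟨?_, Gam.zero _⟩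
    simpa [AB] using Gam.mono 1 zero_le_one 0 0 0 rfl
  | one =>
    refine ⟨Gam.zero _, ?_⟩
    simpa [AB] using Gam.mono 1 zero_le_one 0 0 0 rfl
  | more n h0 h1 =>
    obtain ⟨hA0, hB0⟩ := h0
    obtain ⟨hA1, hB1⟩ := h1
    simp only [Nat.add_sub_cancel] at hB1
    constructor
    · have := ((hA1.T).add _ _ _ ((hB1.smul (mul_nonneg ha hb)).mulX)).add _ _ _
        ((hA0.smul (d := (1 - a) * ((n : ℝ) + 1)) (by positivity)).mulX)
      convert this using 1
      rw [A_rec]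
      push_cast
      ring
    · have e : Gam (n + 1) (X * (C ((1 - a) * ((n : ℝ) + 1)) * (AB a n).2)) := by
        rcases n with _ | n
        · simpa [AB] using Gam.zero _
        · exact (hB0.smul (by positivity)).mulX
      have := (((hA1.add _ _ _ ((hB1.mul1X).smul ha))).add _ _ _ hB1.T).add _ _ _ e
      change Gam (n + 1) _
      convert this using 1
      rw [B_rec]
      ring

lemma Gam.props {m : ℕ} {f : ℝ[X]} (h : Gam m f) :
    (∀ k, 0 ≤ f.coeff k) ∧ (∀ k, m < k → f.coeff k = 0) ∧
    (∀ k, k ≤ m → f.coeff (m - k) = f.coeff k) ∧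
    (∀ k, 2 * k + 1 ≤ m → f.coeff k ≤ f.coeff (k + 1)) := by
  induction h with
  | zero m => simp
  | add m f g _ _ hf hg =>
    obtain ⟨f1, f2, f3, f4⟩ := hf
    obtain ⟨g1, g2, g3, g4⟩ := hg
    refine ⟨fun k => ?_, fun k hk => ?_, fun k hk => ?_, fun k hk => ?_⟩
    · simpa using add_nonneg (f1 k) (g1 k)
    · simp [f2 k hk, g2 k hk]
    · simp [f3 k hk, g3 k hk]
    · simpa using add_le_add (f4 k hk) (g4 k hk)
  | mono c hc i j m hm =>
    have hco : ∀ k, (C c * X ^ i * (1 + X) ^ j : ℝ[X]).coeff k =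
        c * if i ≤ k then (j.choose (k - i) : ℝ) else 0 := by
      intro k
      rw [mul_assoc, coeff_C_mul, coeff_X_pow_mul']
      simp [coeff_one_add_X_pow]
    refine ⟨fun k => ?_, fun k hk => ?_, fun k hk => ?_, fun k hk => ?_⟩
    · rw [hco]
      split_ifs <;> positivity
    · rw [hco, if_pos (by omega), Nat.choose_eq_zero_of_lt (by omega)]
      simp
    · rw [hco, hco]
      by_cases h1 : i ≤ k
      · by_cases h2 : i ≤ m - k
        · rw [if_pos h1, if_pos h2, ← Nat.choose_symm (show k - i ≤ j by omega)]
          congr 3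
          omega
        · rw [if_pos h1, if_neg h2, Nat.choose_eq_zero_of_lt (by omega)]
          simp
      · rw [if_neg h1, if_pos (by omega), Nat.choose_eq_zero_of_lt (by omega)]
        simp
    · rw [hco, hco]
      refine mul_le_mul_of_nonneg_left ?_ hc
      by_cases h1 : i ≤ k
      · rw [if_pos h1, if_pos (by omega), Nat.cast_le]
        have : k + 1 - i = (k - i) + 1 := by omega
        rw [this]
        have h3 := Nat.choose_succ_right_eq j (k - i)
        have h4 : k - i + 1 ≤ j - (k - i) := by omega
        have h5 : j.choose (k - i) * (k - i + 1) ≤ j.choose (k - i + 1) * (k - i + 1) := by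
          rw [h3]
          exact Nat.mul_le_mul_left _ h4
        exact Nat.le_of_mul_le_mul_right h5 (by omega)
      · rw [if_neg h1]
        split_ifs <;> positivity

lemma pC_altInc (a : ℝ) (ha : 0 ≤ a) (ha1 : a ≤ 1) (n : ℕ) (hn : 1 ≤ n) (c : ℝ) (hc : 0 ≤ c) :
    AltInc n (C c * pC a n) := by
  obtain ⟨hA, hB⟩ := Gam_AB a ha ha1 n
  obtain ⟨A1, A2, A3, A4⟩ := hA.props
  obtain ⟨B1, B2, B3, B4⟩ := hB.props
  rw [pC_eq_AB]
  obtain ⟨m, rfl⟩ : ∃ m, n = m + 1 := ⟨n - 1, by omega⟩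
  simp only [Nat.add_sub_cancel] at *
  have hs : ∀ k, (C c * ((AB a (m + 1)).1 + C a * X * (AB a (m + 1)).2)).coeff (k + 1)
      = c * ((AB a (m + 1)).1.coeff (k + 1) + a * (AB a (m + 1)).2.coeff k) := by
    intro k
    rw [coeff_C_mul, coeff_add, mul_assoc, coeff_C_mul, coeff_X_mul]
  have h0 : (C c * ((AB a (m + 1)).1 + C a * X * (AB a (m + 1)).2)).coeff 0
      = c * (AB a (m + 1)).1.coeff 0 := by
    simp
  refine ⟨?_, ?_, ?_⟩
  · rw [h0]
    exact mul_nonneg hc (A1 0)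
  · intro k hk
    rcases k with _ | k
    · rw [Nat.sub_zero, hs, h0]
      refine mul_le_mul_of_nonneg_left ?_ hc
      have := A3 0 (by omega)
      rw [Nat.sub_zero] at this
      rw [this]
      have := mul_nonneg ha (B1 m)
      linarith
    · have e : m + 1 - (k + 1) = (m - k - 1) + 1 := by omega
      rw [e, hs, hs]
      refine mul_le_mul_of_nonneg_left ?_ hc
      have h1 := A3 (k + 1) (by omega)
      rw [e] at h1
      rw [h1]
      have h2 := B3 (k + 1) (by omega)
      have h3 := B4 k (by omega)
      have e2 : m - (k + 1) = m - k - 1 := by omega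
      rw [e2] at h2
      rw [h2]
      have := mul_le_mul_of_nonneg_left h3 ha
      linarith
  · intro k hk
    have e : m + 1 - k = (m - k) + 1 := by omega
    rw [e, hs, hs]
    refine mul_le_mul_of_nonneg_left ?_ hc
    have h1 := A3 k (by omega)
    rw [e] at h1
    rw [h1, B3 k (by omega)]
    have := A4 k (by omega)
    linarith

lemma reflect_pC (a : ℝ) (ha : 0 ≤ a) (ha1 : a ≤ 1) (n : ℕ) (hn : 1 ≤ n) :
    reflect n (pC a n) = (AB a n).1 + C a * (AB a n).2 := by
  obtain ⟨hA, hB⟩ := Gam_AB a ha ha1 n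
  obtain ⟨A1, A2, A3, A4⟩ := hA.props
  obtain ⟨B1, B2, B3, B4⟩ := hB.props
  rw [pC_eq_AB]
  obtain ⟨m, rfl⟩ : ∃ m, n = m + 1 := ⟨n - 1, by omega⟩
  simp only [Nat.add_sub_cancel] at *
  ext k
  rw [coeff_reflect]
  by_cases hk : k ≤ m + 1
  · rw [revAt_le hk, coeff_add, coeff_add, A3 k hk, mul_assoc, coeff_C_mul, coeff_C_mul]
    congr 2
    by_cases hk2 : k ≤ m
    · have e : m + 1 - k = (m - k) + 1 := by omega
      rw [e, coeff_X_mul, B3 k hk2]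
    · have e : m + 1 - k = 0 := by omega
      rw [e, B2 k (by omega)]
      simp
  · rw [revAt_eq_self_of_lt (by omega), coeff_add, coeff_add, mul_assoc, coeff_C_mul, coeff_C_mul,
      A2 k (by omega), B2 k (by omega)]
    obtain ⟨j, rfl⟩ : ∃ j, k = j + 1 := ⟨k - 1, by omega⟩
    rw [coeff_X_mul, B2 j (by omega)]

/-! ### Partial fractions -/

/-- The polynomial with leading coefficient `α` and simple zeros `S`. -/
noncomputable def Af (α : ℝ) (S : Finset ℝ) : ℝ[X] := C α * ∏ φ ∈ S, (X - C φ)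

/-- `Af α S` divided by `X - θ`. -/
noncomputable def Lf (α : ℝ) (S : Finset ℝ) (θ : ℝ) : ℝ[X] :=
  C α * ∏ φ ∈ S.erase θ, (X - C φ)

lemma Lf_mul (α : ℝ) (S : Finset ℝ) (θ : ℝ) (hθ : θ ∈ S) :
    (X - C θ) * Lf α S θ = Af α S := by
  unfold Lf Af
  rw [← Finset.mul_prod_erase S (fun φ => X - C φ) hθ]
  ring

lemma Af_eval_mem (α : ℝ) (S : Finset ℝ) (θ : ℝ) (hθ : θ ∈ S) : (Af α S).eval θ = 0 := by
  rw [← Lf_mul α S θ hθ]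
  simp

lemma Lf_eval_self (α : ℝ) (S : Finset ℝ) (θ : ℝ) (hθ : θ ∈ S) :
    (Lf α S θ).eval θ = (derivative (Af α S)).eval θ := by
  rw [← Lf_mul α S θ hθ]
  simp [derivative_mul]

lemma Lf_eval_ne (α : ℝ) (S : Finset ℝ) (θ φ : ℝ) (hφ : φ ∈ S) (h : φ ≠ θ) :
    (Lf α S θ).eval φ = 0 := by
  unfold Lf
  rw [eval_mul, eval_prod, Finset.prod_eq_zero (Finset.mem_erase.mpr ⟨h, hφ⟩)]
  · simp
  · simp

lemma Lf_eval_self_ne (α : ℝ) (hα : α ≠ 0) (S : Finset ℝ) (θ : ℝ) :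
    (Lf α S θ).eval θ ≠ 0 := by
  unfold Lf
  rw [eval_mul, eval_prod, eval_C]
  refine mul_ne_zero hα (Finset.prod_ne_zero_iff.mpr fun φ hφ => ?_)
  have := (Finset.mem_erase.mp hφ).1
  simpa [sub_eq_zero] using this.symm

lemma natDegree_prodX (S : Finset ℝ) : (∏ φ ∈ S, (X - C φ)).natDegree = S.card := by
  rw [natDegree_prod_of_monic _ _ (fun φ _ => monic_X_sub_C φ)]
  simp

lemma Lf_natDegree (α : ℝ) (S : Finset ℝ) (θ : ℝ) (hθ : θ ∈ S) :
    (Lf α S θ).natDegree < S.card := by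
  unfold Lf
  refine lt_of_le_of_lt (natDegree_C_mul_le _ _) ?_
  rw [natDegree_prodX]
  exact Finset.card_erase_lt_of_mem hθ

lemma Af_natDegree (α : ℝ) (S : Finset ℝ) : (Af α S).natDegree ≤ S.card := by
  unfold Af
  refine le_trans (natDegree_C_mul_le _ _) ?_
  rw [natDegree_prodX]

lemma Af_coeff (α : ℝ) (S : Finset ℝ) : (Af α S).coeff S.card = α := by
  unfold Af
  rw [coeff_C_mul]
  have : (∏ φ ∈ S, (X - C φ)).coeff S.card = 1 := by
    have h := monic_prod_of_monic S (fun φ : ℝ => X - C φ) (fun φ _ => monic_X_sub_C φ)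
    have h2 := h.coeff_natDegree
    rwa [natDegree_prodX] at h2
  rw [this, mul_one]

lemma partial_fractions (α : ℝ) (hα : α ≠ 0) (S : Finset ℝ) (P : ℝ[X])
    (hP : P.natDegree ≤ S.card) :
    P = C (P.coeff S.card / α) * Af α S +
      ∑ θ ∈ S, C (P.eval θ / (derivative (Af α S)).eval θ) * Lf α S θ := by
  rw [← sub_eq_zero]
  set Q := P - (C (P.coeff S.card / α) * Af α S +
      ∑ θ ∈ S, C (P.eval θ / (derivative (Af α S)).eval θ) * Lf α S θ) with hQ
  have hdeg : Q.degree < S.card := by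
    have hsum : (∑ θ ∈ S, C (P.eval θ / (derivative (Af α S)).eval θ) * Lf α S θ).degree
        < S.card := by
      refine lt_of_le_of_lt (degree_sum_le _ _) ?_
      rw [Finset.sup_lt_iff (WithBot.bot_lt_coe _)]
      intro θ hθ
      refine lt_of_le_of_lt degree_le_natDegree ?_
      exact_mod_cast lt_of_le_of_lt (natDegree_C_mul_le _ _) (Lf_natDegree α S θ hθ)
    have h1 : (P - C (P.coeff S.card / α) * Af α S).degree < S.card := by
      rw [degree_lt_iff_coeff_zero]
      intro k hk
      rcases hk.eq_or_lt with rfl | hk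
      · rw [coeff_sub, coeff_C_mul, Af_coeff]
        field_simp
        simp
      · rw [coeff_sub, coeff_C_mul, coeff_eq_zero_of_natDegree_lt (lt_of_le_of_lt hP hk),
          coeff_eq_zero_of_natDegree_lt (lt_of_le_of_lt (Af_natDegree α S) hk)]
        simp
    rw [hQ, ← sub_sub]
    exact lt_of_le_of_lt (degree_sub_le _ _) (max_lt h1 hsum)
  refine eq_zero_of_degree_lt_of_eval_finset_eq_zero S hdeg ?_
  intro φ hφ
  rw [hQ, eval_sub, eval_add, eval_mul, Af_eval_mem α S φ hφ, eval_finsetSum,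
    Finset.sum_eq_single φ]
  · rw [eval_mul, eval_C, Lf_eval_self α S φ hφ]
    have := Lf_eval_self_ne α hα S φ
    rw [Lf_eval_self α S φ hφ] at this
    rw [mul_zero, zero_add, eval_C, div_mul_cancel₀ _ this, sub_self]
  · intro θ _ hne
    rw [eval_mul, Lf_eval_ne α S θ φ hφ hne.symm, mul_zero]
  · intro h
    exact absurd hφ h

lemma Af_derivative (α : ℝ) (S : Finset ℝ) : derivative (Af α S) = ∑ θ ∈ S, Lf α S θ := by
  unfold Af Lf
  rw [derivative_C_mul, derivative_prod_finset, Finset.mul_sum]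
  refine Finset.sum_congr rfl fun θ _ => ?_
  simp

lemma wronskian_L (α : ℝ) (S : Finset ℝ) (θ : ℝ) (hθ : θ ∈ S) :
    derivative (Lf α S θ) * Af α S - Lf α S θ * derivative (Af α S) = - Lf α S θ ^ 2 := by
  rw [← Lf_mul α S θ hθ]
  simp only [derivative_mul, derivative_sub, derivative_X, derivative_C]
  ring

/-- splitting from the complex zeros. -/
lemma exists_Af (P : ℝ[X]) (hP : P ≠ 0) (hre : ∀ z : ℂ, aeval z P = 0 → z.im = 0)
    (hs : ∀ x : ℝ, P.eval x = 0 → (derivative P).eval x ≠ 0) :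
    ∃ S : Finset ℝ, P = Af P.leadingCoeff S ∧ S.card = P.natDegree ∧
      ∀ x, x ∈ S ↔ P.eval x = 0 := by
  have hsp : P.Splits := by
    refine Splits.of_splits_map (algebraMap ℝ ℂ) (IsAlgClosed.splits _) ?_
    intro z hz
    have hz' : aeval z P = 0 := by
      have := (mem_roots'.mp hz).2
      rwa [IsRoot, eval_map_algebraMap] at this
    exact ⟨z.re, Complex.ext (by simp) (by simp [hre z hz'])⟩
  have hnd : P.roots.Nodup := by
    rw [Multiset.nodup_iff_count_le_one]
    intro x
    rw [count_roots]
    by_contra hc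
    push Not at hc
    have := (one_lt_rootMultiplicity_iff_isRoot hP).mp hc
    exact hs x this.1 this.2
  refine ⟨P.roots.toFinset, ?_, ?_, ?_⟩
  · conv_lhs => rw [hsp.eq_prod_roots]
    unfold Af
    congr 1
    rw [Finset.prod_multiset_map_count]
    refine Finset.prod_congr rfl fun x hx => ?_
    rw [Multiset.count_eq_one_of_mem hnd (by simpa using hx), pow_one]
  · rw [Multiset.toFinset_card_of_nodup hnd]
    exact hsp.natDegree_eq_card_roots.symm
  · intro x
    simp [hP]

/-- `P/A` for a sum of partial fractions, complex evaluation. -/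
lemma aeval_Lf (α : ℝ) (S : Finset ℝ) (θ : ℝ) (hθ : θ ∈ S) (z : ℂ) (hz : 0 < z.im) :
    aeval z (Lf α S θ) = aeval z (Af α S) * (z - θ)⁻¹ := by
  have h : z - θ ≠ 0 := by
    intro h
    have := congrArg Complex.im h
    simp at this
    linarith
  rw [← Lf_mul α S θ hθ]
  simp only [map_mul, map_sub, aeval_X, aeval_C, Complex.coe_algebraMap]
  field_simp

lemma aeval_Af_ne (α : ℝ) (hα : α ≠ 0) (S : Finset ℝ) (z : ℂ) (hz : 0 < z.im) :
    aeval z (Af α S) ≠ 0 := by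
  unfold Af
  rw [map_mul, map_prod]
  refine mul_ne_zero (by simpa using hα) (Finset.prod_ne_zero_iff.mpr fun θ _ => ?_)
  intro h
  have := congrArg Complex.im h
  simp at this
  linarith

lemma inv_im_neg (z : ℂ) (θ : ℝ) (hz : 0 < z.im) : ((z - θ)⁻¹).im ≤ 0 := by
  rw [Complex.inv_im]
  simp only [Complex.sub_im, Complex.ofReal_im, sub_zero]
  exact div_nonpos_of_nonpos_of_nonneg (by linarith) (Complex.normSq_nonneg _)

/-! ### The induction -/

lemma step_rep (a N α : ℝ) (S : Finset ℝ) (hN : N = S.card + 1)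
    (B A₀ : ℝ[X]) (β β' : ℝ) (c e : ℝ → ℝ)
    (hB : B = C β * Af α S + ∑ θ ∈ S, C (c θ) * Lf α S θ)
    (hA₀ : A₀ = C β' * Af α S + ∑ θ ∈ S, C (e θ) * Lf α S θ) :
    X * (C N * Af α S + (1 - X) * derivative (Af α S) + C (a * (1 - a)) * B
      + C ((1 - a) * N) * A₀)
    = (C (1 + a * (1 - a) * β + (1 - a) * N * β') * X
        + C (∑ θ ∈ S, ((1 - θ) + a * (1 - a) * c θ + (1 - a) * N * e θ))) * Af α S
      - ∑ θ ∈ S, C (-θ * ((1 - θ) + a * (1 - a) * c θ + (1 - a) * N * e θ)) * Lf α S θ := by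
  have key : ∀ θ ∈ S, X * (1 - X) * Lf α S θ + C (a * (1 - a)) * (X * (C (c θ) * Lf α S θ))
      + C ((1 - a) * N) * (X * (C (e θ) * Lf α S θ))
      = C ((1 - θ) + a * (1 - a) * c θ + (1 - a) * N * e θ) * Af α S - X * Af α S
        - C (-θ * ((1 - θ) + a * (1 - a) * c θ + (1 - a) * N * e θ)) * Lf α S θ := by
    intro θ hθ
    rw [← Lf_mul α S θ hθ]
    simp only [C_add, C_mul, C_sub, C_neg, C_1]
    ring
  have hsum := Finset.sum_congr (rfl : S = S) key
  simp only [Finset.sum_add_distrib, Finset.sum_sub_distrib, ← Finset.mul_sum, ← Finset.sum_mul,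
    Finset.sum_const, nsmul_eq_mul, ← map_sum C] at hsum
  rw [Finset.sum_sub_distrib] at hsum
  rw [Af_derivative, hB, hA₀]
  have hNC : (C N : ℝ[X]) = (S.card : ℝ[X]) + 1 := by
    rw [hN]
    simp
  have hk : (C (∑ θ ∈ S, ((1 - θ) + a * (1 - a) * c θ + (1 - a) * N * e θ)) : ℝ[X])
      = C (∑ θ ∈ S, (1 : ℝ)) - C (∑ θ ∈ S, θ) + C a * (1 - C a) * C (∑ θ ∈ S, c θ)
        + (1 - C a) * (S.card + 1) * C (∑ θ ∈ S, e θ) := by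
    rw [Finset.sum_add_distrib, Finset.sum_add_distrib, Finset.sum_sub_distrib, ← Finset.mul_sum,
      ← Finset.mul_sum, ← hNC]
    simp only [C_add, C_mul, C_sub, C_1]
  rw [hk]
  simp only [C_add, C_mul, C_sub, C_1, hNC] at hsum ⊢
  linear_combination hsum

lemma wr_sum (α : ℝ) (S : Finset ℝ) (c : ℝ → ℝ) :
    derivative (∑ θ ∈ S, C (c θ) * Lf α S θ) * Af α S
      - (∑ θ ∈ S, C (c θ) * Lf α S θ) * derivative (Af α S)
    = - ∑ θ ∈ S, C (c θ) * Lf α S θ ^ 2 := by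
  rw [derivative_sum, Finset.sum_mul, Finset.sum_mul, ← Finset.sum_sub_distrib,
    ← Finset.sum_neg_distrib]
  refine Finset.sum_congr rfl fun θ hθ => ?_
  rw [derivative_C_mul]
  linear_combination C (c θ) * wronskian_L α S θ hθ

/-- Wronskian of `A₁ = (κX + k) A - ∑ μ L` against `A`. -/
lemma wr_rep (α : ℝ) (S : Finset ℝ) (κ k : ℝ) (μ : ℝ → ℝ) (A₁ : ℝ[X])
    (h : A₁ = (C κ * X + C k) * Af α S - ∑ θ ∈ S, C (μ θ) * Lf α S θ) :
    derivative A₁ * Af α S - A₁ * derivative (Af α S)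
      = C κ * Af α S ^ 2 + ∑ θ ∈ S, C (μ θ) * Lf α S θ ^ 2 := by
  have := wr_sum α S μ
  rw [h]
  simp only [derivative_sub, derivative_mul, derivative_add, derivative_C, derivative_X]
  linear_combination -this

lemma rep_eval_mem (α : ℝ) (S : Finset ℝ) (κ k : ℝ) (μ : ℝ → ℝ) (A₁ : ℝ[X])
    (h : A₁ = (C κ * X + C k) * Af α S - ∑ θ ∈ S, C (μ θ) * Lf α S θ) (φ : ℝ) (hφ : φ ∈ S) :
    A₁.eval φ = - (μ φ * (Lf α S φ).eval φ) := by
  rw [h, eval_sub, eval_mul, Af_eval_mem α S φ hφ, eval_finsetSum, Finset.sum_eq_single φ]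
  · simp
  · intro θ _ hne
    rw [eval_mul, Lf_eval_ne α S θ φ hφ hne.symm, mul_zero]
  · intro h'
    exact absurd hφ h'

/-- conjugation symmetry of the zeros -/
lemma aeval_conj_zero (P : ℝ[X]) (h : ∀ z : ℂ, 0 < z.im → aeval z P ≠ 0) (z : ℂ)
    (hz : aeval z P = 0) : z.im = 0 := by
  rcases lt_trichotomy z.im 0 with h0 | h0 | h0
  · exfalso
    refine h (starRingEnd ℂ z) (by simpa using h0) ?_
    rw [aeval_conj, hz, map_zero]
  · exact h0
  · exact absurd hz (h z h0)

/-- no zeros in the upper half plane -/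
lemma rep_uhp (α : ℝ) (hα : α ≠ 0) (S : Finset ℝ) (κ k : ℝ) (μ : ℝ → ℝ) (A₁ : ℝ[X])
    (h : A₁ = (C κ * X + C k) * Af α S - ∑ θ ∈ S, C (μ θ) * Lf α S θ)
    (hκ : 0 < κ) (hμ : ∀ θ ∈ S, 0 ≤ μ θ) (z : ℂ) (hz : 0 < z.im) : aeval z A₁ ≠ 0 := by
  have h1 : aeval z A₁ = aeval z (Af α S) * (κ * z + k - ∑ θ ∈ S, (μ θ : ℂ) * (z - θ)⁻¹) := by
    rw [h, map_sub, map_mul, map_sum, mul_sub, Finset.mul_sum]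
    congr 1
    · simp only [map_add, map_mul, aeval_C, aeval_X, Complex.coe_algebraMap]
      ring
    · refine Finset.sum_congr rfl fun θ hθ => ?_
      rw [map_mul, aeval_Lf α S θ hθ z hz, aeval_C]
      simp only [Complex.coe_algebraMap]
      ring
  rw [h1]
  refine mul_ne_zero (aeval_Af_ne α hα S z hz) ?_
  intro h2
  have h3 := congrArg Complex.im h2
  simp only [Complex.sub_im, Complex.add_im, Complex.im_sum,
    Complex.im_ofReal_mul, Complex.ofReal_im, Complex.zero_im] at h3
  have h4 : ∑ θ ∈ S, μ θ * ((z - (θ : ℂ))⁻¹).im ≤ 0 :=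
    Finset.sum_nonpos fun θ hθ => mul_nonpos_of_nonneg_of_nonpos (hμ θ hθ) (inv_im_neg z θ hz)
  have h5 := mul_pos hκ hz
  linarith

/-- the key sign of the determinant -/
lemma det_nonneg (a N α : ℝ) (ha : 0 ≤ a) (ha1 : a ≤ 1) (hN : 0 ≤ N) (S : Finset ℝ)
    (hS : ∀ θ ∈ S, θ ≤ 0) (B A₀ B₀ : ℝ[X]) (β : ℝ) (hβ : 0 ≤ β) (c : ℝ → ℝ)
    (hc : ∀ θ ∈ S, 0 ≤ c θ)
    (hB : B = C β * Af α S + ∑ θ ∈ S, C (c θ) * Lf α S θ) (x : ℝ) (hx : x ≤ 0)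
    (hD : 0 ≤ B.eval x * A₀.eval x - (Af α S).eval x * B₀.eval x)
    (A₁ B₁ : ℝ[X])
    (hA₁ : A₁ = X * (C N * Af α S + (1 - X) * derivative (Af α S) + C (a * (1 - a)) * B
      + C ((1 - a) * N) * A₀))
    (hB₁ : B₁ = Af α S + C a * (1 + X) * B + X * (C (N - 1) * B + (1 - X) * derivative B
      + C ((1 - a) * N) * B₀)) :
    0 ≤ B₁.eval x * (Af α S).eval x - A₁.eval x * B.eval x := by
  have hw : derivative B * Af α S - B * derivative (Af α S)
      = - ∑ θ ∈ S, C (c θ) * Lf α S θ ^ 2 := by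
    have := wr_sum α S c
    rw [hB]
    simp only [derivative_add, derivative_mul, derivative_C]
    linear_combination this
  have hw' := congrArg (eval x) hw
  have hAB : (Af α S).eval x * B.eval x = β * (Af α S).eval x ^ 2
      + ∑ θ ∈ S, c θ * ((x - θ) * (Lf α S θ).eval x ^ 2) := by
    have : (Af α S) * B = C β * (Af α S) ^ 2
      + ∑ θ ∈ S, C (c θ) * ((X - C θ) * (Lf α S θ) ^ 2) := by
      rw [hB, mul_add, Finset.mul_sum]
      congr 1
      · ring
      · refine Finset.sum_congr rfl fun θ hθ => ?_
        rw [← Lf_mul α S θ hθ]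
        ring
    have := congrArg (eval x) this
    simpa [eval_finsetSum] using this
  simp only [eval_sub, eval_mul, eval_neg, eval_finsetSum, eval_C, eval_pow] at hw'
  have hid : B₁.eval x * (Af α S).eval x - A₁.eval x * B.eval x
      = (Af α S).eval x ^ 2 + (a - (1 - a) * x) * ((Af α S).eval x * B.eval x)
        + x * (1 - x) * ((derivative B).eval x * (Af α S).eval x
            - B.eval x * (derivative (Af α S)).eval x)
        - a * (1 - a) * x * B.eval x ^ 2
        - (1 - a) * N * x * (B.eval x * A₀.eval x - (Af α S).eval x * B₀.eval x) := by
    rw [hA₁, hB₁]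
    simp only [eval_sub, eval_mul, eval_add, eval_C, eval_X, eval_one]
    ring
  rw [hid, hw', hAB]
  have hb : 0 ≤ 1 - a := by linarith
  have t1 : 0 ≤ (a - (1 - a) * x) * (β * (Af α S).eval x ^ 2) := by
    have : 0 ≤ a - (1 - a) * x := by nlinarith
    positivity
  have t2 : 0 ≤ - (a * (1 - a) * x * B.eval x ^ 2) := by
    have := mul_nonneg (mul_nonneg (mul_nonneg ha hb) (neg_nonneg.mpr hx)) (sq_nonneg (B.eval x))
    linarith
  have t3 := mul_nonneg (mul_nonneg (mul_nonneg hb hN) (neg_nonneg.mpr hx)) hD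
  have t4 : 0 ≤ (a - (1 - a) * x) * (∑ θ ∈ S, c θ * ((x - θ) * (Lf α S θ).eval x ^ 2))
      - x * (1 - x) * ∑ θ ∈ S, c θ * (Lf α S θ).eval x ^ 2 := by
    rw [Finset.mul_sum, Finset.mul_sum, ← Finset.sum_sub_distrib]
    refine Finset.sum_nonneg fun θ hθ => ?_
    have h1 : 0 ≤ a * (x ^ 2 - θ) + (1 - a) * (x * (θ - 1)) := by
      have := hS θ hθ
      have h2 : 0 ≤ x ^ 2 - θ := by nlinarith [sq_nonneg x]
      have h3 : 0 ≤ x * (θ - 1) := mul_nonneg_of_nonpos_of_nonpos hx (by linarith)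
      positivity
    have h4 := mul_nonneg (mul_nonneg h1 (hc θ hθ)) (sq_nonneg ((Lf α S θ).eval x))
    have h5 : (a - (1 - a) * x) * (c θ * ((x - θ) * (Lf α S θ).eval x ^ 2))
      - x * (1 - x) * (c θ * (Lf α S θ).eval x ^ 2)
      = (a * (x ^ 2 - θ) + (1 - a) * (x * (θ - 1))) * c θ * (Lf α S θ).eval x ^ 2 := by ring
    rw [h5]
    exact h4
  have t5 := sq_nonneg ((Af α S).eval x)
  linarith

/-- The inductive invariant. -/
def DInv (a : ℝ) (m : ℕ) : Prop :=
  ∃ (α : ℝ) (S : Finset ℝ), 0 < α ∧ S.card = m + 1 ∧ 0 ∈ S ∧ (∀ θ ∈ S, θ ≤ 0) ∧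
    (AB a (m + 2)).1 = Af α S ∧
    (∀ θ ∈ S, 0 ≤ (AB a (m + 2)).2.eval θ * (derivative (Af α S)).eval θ) ∧
    (∀ θ ∈ S, 0 ≤ (AB a (m + 1)).1.eval θ * (derivative (Af α S)).eval θ) ∧
    0 < (derivative (Af α S)).eval 0 ∧
    ∀ x ≤ 0, 0 ≤ (AB a (m + 2)).2.eval x * (AB a (m + 1)).1.eval x
      - (AB a (m + 2)).1.eval x * (AB a (m + 1)).2.eval x

lemma DInv_base (a : ℝ) (ha : 0 ≤ a) (ha1 : a < 1) : DInv a 0 := by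
  have hA : (AB a 2).1 = C ((1 - a) * (1 + a)) * X := by
    rw [A_rec]
    simp [AB]
    ring
  have hB : (AB a 1) = (0, 1) := rfl
  have hb : 0 < (1 - a) * (1 + a) := mul_pos (by linarith) (by linarith)
  have hAf : Af ((1 - a) * (1 + a)) {0} = C ((1 - a) * (1 + a)) * X := by
    simp [Af]
  have hB2 : (AB a 2).2 = C a * (1 + X) := by
    rw [B_rec]
    simp [AB]
  refine ⟨(1 - a) * (1 + a), {0}, hb, rfl, by simp, by simp, ?_, ?_, ?_, ?_, ?_⟩
  · rw [hAf]; exact hA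
  · intro θ hθ
    rw [hAf]
    simp only [zero_add, hB2, derivative_C_mul, derivative_X, mul_one, eval_C]
    rw [Finset.mem_singleton.mp hθ]
    simp only [eval_mul, eval_C, eval_add, eval_one, eval_X]
    have := mul_nonneg ha hb.le
    linarith
  · simp [hB]
  · rw [hAf]
    simp only [derivative_C_mul, derivative_X, mul_one, eval_C]
    exact hb
  · intro x hx
    simp only [zero_add, hA, hB, eval_zero, mul_zero, eval_one, mul_one, eval_mul, eval_C, eval_X,
      zero_sub]
    have := mul_nonneg hb.le (neg_nonneg.mpr hx)
    linarith

/-- nonnegative partial fractions for `P` of degree at most `card S` -/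
lemma pf_nonneg (α : ℝ) (hα : 0 < α) (S : Finset ℝ) (P : ℝ[X]) (hP : ∀ k, 0 ≤ P.coeff k)
    (hd : ∀ k, S.card < k → P.coeff k = 0)
    (hs : ∀ θ ∈ S, 0 ≤ P.eval θ * (derivative (Af α S)).eval θ) :
    ∃ (β : ℝ) (c : ℝ → ℝ), 0 ≤ β ∧ (∀ θ ∈ S, 0 ≤ c θ) ∧
      P = C β * Af α S + ∑ θ ∈ S, C (c θ) * Lf α S θ := by
  refine ⟨_, _, ?_, ?_, partial_fractions α hα.ne' S P ?_⟩
  · exact div_nonneg (hP _) hα.le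
  · intro θ hθ
    have h := hs θ hθ
    rcases eq_or_ne ((derivative (Af α S)).eval θ) 0 with h0 | h0
    · simp [h0]
    · rw [div_eq_mul_inv]
      have : P.eval θ * ((derivative (Af α S)).eval θ)⁻¹
          = (P.eval θ * (derivative (Af α S)).eval θ) * (((derivative (Af α S)).eval θ)⁻¹) ^ 2 := by
        field_simp
      rw [this]
      positivity
  · exact natDegree_le_iff_coeff_eq_zero.mpr hd

lemma eval_nonneg_of_coeff (P : ℝ[X]) (hP : ∀ k, 0 ≤ P.coeff k) (x : ℝ) (hx : 0 ≤ x) :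
    0 ≤ P.eval x := by
  rw [eval_eq_sum_range]
  exact Finset.sum_nonneg fun k _ => mul_nonneg (hP k) (by positivity)

lemma eval_pos_of_coeff (P : ℝ[X]) (h0 : P ≠ 0) (hP : ∀ k, 0 ≤ P.coeff k) (x : ℝ) (hx : 0 < x) :
    0 < P.eval x := by
  rw [eval_eq_sum_range]
  refine Finset.sum_pos' (fun k _ => mul_nonneg (hP k) (by positivity))
    ⟨P.natDegree, by simp, ?_⟩
  have : 0 < P.coeff P.natDegree := lt_of_le_of_ne (hP _) (leadingCoeff_ne_zero.mpr h0).symm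
  positivity

lemma DInv_step (a : ℝ) (ha : 0 ≤ a) (ha1 : a < 1) (m : ℕ) (h : DInv a m) : DInv a (m + 1) := by
  obtain ⟨α, S, hα, hcard, h0S, hS, hA, hsB, hsA₀, hd0, hD⟩ := h
  obtain ⟨-, gB⟩ := Gam_AB a ha ha1.le (m + 2)
  obtain ⟨gA₀, -⟩ := Gam_AB a ha ha1.le (m + 1)
  obtain ⟨gA₁, -⟩ := Gam_AB a ha ha1.le (m + 3)
  have hA₁ := A_rec a (m + 1)
  have hB₁ := B_rec a (m + 1)
  rw [show m + 1 + 2 = m + 3 from rfl, show m + 1 + 1 = m + 2 from rfl] at hA₁ hB₁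
  unfold DInv
  rw [show m + 1 + 2 = m + 3 from rfl, show m + 1 + 1 = m + 2 from rfl]
  rw [hA] at hA₁ hB₁ hD ⊢
  set B := (AB a (m + 2)).2
  set A₀ := (AB a (m + 1)).1
  set B₀ := (AB a (m + 1)).2
  set A₁ := (AB a (m + 3)).1
  set B₁ := (AB a (m + 3)).2
  have pB := gB.props
  have pA₀ := gA₀.props
  have pA₁ := gA₁.props
  obtain ⟨β, c, hβ, hc, hB⟩ := pf_nonneg α hα S B pB.1
    (fun k hk => pB.2.1 k (by omega)) hsB
  obtain ⟨β', e, hβ', he, hA₀⟩ := pf_nonneg α hα S A₀ pA₀.1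
    (fun k hk => pA₀.2.1 k (by omega)) hsA₀
  set N : ℝ := ((m + 1 : ℕ) : ℝ) + 1 with hN
  have hN0 : 0 < N := by positivity
  have hNS : N = S.card + 1 := by rw [hN, hcard]
  have hN1 : (((m + 1 : ℕ) : ℝ)) = N - 1 := by rw [hN]; ring
  rw [hN1] at hB₁
  have hb : 0 < 1 - a := by linarith
  have hrep := hA₁.trans (step_rep a N α S hNS B A₀ β β' c e hB hA₀)
  set κ := 1 + a * (1 - a) * β + (1 - a) * N * β' with hκ
  set k := ∑ θ ∈ S, ((1 - θ) + a * (1 - a) * c θ + (1 - a) * N * e θ)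
  set μ : ℝ → ℝ := fun θ => -θ * ((1 - θ) + a * (1 - a) * c θ + (1 - a) * N * e θ) with hμdef
  change A₁ = (C κ * X + C k) * Af α S - ∑ θ ∈ S, C (μ θ) * Lf α S θ at hrep
  have hκ0 : 0 < κ := by positivity
  have hin : ∀ θ ∈ S, 0 < (1 - θ) + a * (1 - a) * c θ + (1 - a) * N * e θ := by
    intro θ hθ
    have h1 := hS θ hθ
    have h2 := hc θ hθ
    have h3 := he θ hθ
    have h4 : 0 < 1 - θ := by linarith
    positivity
  have hμ : ∀ θ ∈ S, 0 ≤ μ θ := fun θ hθ =>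
    mul_nonneg (by linarith [hS θ hθ]) (hin θ hθ).le
  have hμ0 : ∀ θ ∈ S, μ θ = 0 → θ = 0 := by
    intro θ hθ h
    rcases mul_eq_zero.mp h with h | h
    · linarith
    · exact absurd h (hin θ hθ).ne'
  have hwr := wr_rep α S κ k μ A₁ hrep
  have hwr' : ∀ x, κ * (Af α S).eval x ^ 2 ≤ (derivative A₁).eval x * (Af α S).eval x
      - A₁.eval x * (derivative (Af α S)).eval x := by
    intro x
    have := congrArg (eval x) hwr
    simp only [eval_sub, eval_mul, eval_add, eval_C, eval_pow, eval_finsetSum] at this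
    rw [this]
    have := Finset.sum_nonneg fun θ hθ => mul_nonneg (hμ θ hθ) (sq_nonneg ((Lf α S θ).eval x))
    linarith
  have huhp := rep_uhp α hα.ne' S κ k μ A₁ hrep hκ0 hμ
  have hre := aeval_conj_zero A₁ huhp
  have hne : A₁ ≠ 0 := by
    intro h
    exact huhp Complex.I (by simp) (by rw [h, map_zero])
  have hder0 : 0 < (derivative A₁).eval 0 := by
    have : (derivative A₁).eval 0 = (derivative (Af α S)).eval 0 + a * (1 - a) * B.eval 0
        + (1 - a) * N * A₀.eval 0 := by
      rw [hA₁, derivative_mul]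
      simp only [derivative_X, eval_add, eval_mul, eval_X, zero_mul, add_zero, one_mul, eval_C,
        eval_sub, eval_one, sub_zero, Af_eval_mem α S 0 h0S, mul_zero, zero_add]
    rw [this]
    have h1 := eval_nonneg_of_coeff B pB.1 0 le_rfl
    have h2 := eval_nonneg_of_coeff A₀ pA₀.1 0 le_rfl
    positivity
  have hA0 : ∀ x, A₁.eval x = 0 → (Af α S).eval x = 0 → x = 0 := by
    intro x h1 h2
    have hxS : x ∈ S := by
      unfold Af at h2
      rw [eval_mul, eval_C, eval_prod] at h2
      rcases mul_eq_zero.mp h2 with h | h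
      · exact absurd h hα.ne'
      · obtain ⟨φ, hφ, h⟩ := Finset.prod_eq_zero_iff.mp h
        simp only [eval_sub, eval_X, eval_C] at h
        rwa [sub_eq_zero.mp h]
    rw [rep_eval_mem α S κ k μ A₁ hrep x hxS] at h1
    rcases mul_eq_zero.mp (neg_eq_zero.mp h1) with h | h
    · exact hμ0 x hxS h
    · exact absurd h (Lf_eval_self_ne α hα.ne' S x)
  have hpos : ∀ x, A₁.eval x = 0 → (Af α S).eval x ≠ 0 →
      0 < (derivative A₁).eval x * (Af α S).eval x := by
    intro x h1 h2
    have h3 := hwr' x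
    rw [h1] at h3
    have h4 : 0 < κ * (Af α S).eval x ^ 2 := by positivity
    linarith
  have hs : ∀ x : ℝ, A₁.eval x = 0 → (derivative A₁).eval x ≠ 0 := by
    intro x h1
    by_cases h2 : (Af α S).eval x = 0
    · rw [hA0 x h1 h2]
      exact hder0.ne'
    · intro h3
      have := hpos x h1 h2
      rw [h3] at this
      simp at this
  obtain ⟨T, hT, hTc, hTm⟩ := exists_Af A₁ hne hre hs
  have hlc : 0 < A₁.leadingCoeff := lt_of_le_of_ne (pA₁.1 _) (leadingCoeff_ne_zero.mpr hne).symm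
  have hcoef : A₁.coeff (m + 2) = κ * α := by
    rw [hrep, coeff_sub, add_mul, coeff_add, mul_assoc, coeff_C_mul, coeff_X_mul, coeff_C_mul]
    have e1 : (Af α S).coeff (m + 1) = α := by rw [← hcard]; exact Af_coeff α S
    have e2 : (Af α S).coeff (m + 2) = 0 :=
      coeff_eq_zero_of_natDegree_lt (lt_of_le_of_lt (Af_natDegree α S) (by omega))
    have e3 : (∑ θ ∈ S, C (μ θ) * Lf α S θ).coeff (m + 2) = 0 := by
      rw [finset_sum_coeff]
      refine Finset.sum_eq_zero fun θ hθ => ?_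
      rw [coeff_C_mul, coeff_eq_zero_of_natDegree_lt, mul_zero]
      exact lt_trans (Lf_natDegree α S θ hθ) (by omega)
    rw [e1, e2, e3]
    ring
  have hA₁0 : A₁.eval 0 = 0 := by rw [hA₁]; simp
  have hdeg : A₁.natDegree = m + 2 := by
    refine le_antisymm ?_ (le_natDegree_of_ne_zero ?_)
    · rw [natDegree_le_iff_coeff_eq_zero]
      intro j hj
      rcases eq_or_lt_of_le (Nat.succ_le_of_lt hj) with h | h
      · have h5 := pA₁.2.2.1 0 (by omega)
        rw [← h, show (m + 2).succ = m + 3 - 0 from rfl, h5, coeff_zero_eq_eval_zero, hA₁0]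
      · exact pA₁.2.1 j (by omega)
    · rw [hcoef]; positivity
  have hTle : ∀ θ ∈ T, θ ≤ 0 := by
    intro θ hθ
    by_contra hc
    push Not at hc
    have := eval_pos_of_coeff A₁ hne pA₁.1 θ hc
    rw [(hTm θ).mp hθ] at this
    exact lt_irrefl _ this
  have hDn : ∀ x ≤ 0, 0 ≤ B₁.eval x * (Af α S).eval x - A₁.eval x * B.eval x := by
    intro x hx
    exact det_nonneg a N α ha ha1.le hN0.le S hS B A₀ B₀ β hβ c hc hB x hx (hD x hx) A₁ B₁ hA₁ hB₁
  refine ⟨A₁.leadingCoeff, T, hlc, by omega, (hTm 0).mpr hA₁0, hTle, hT, ?_, ?_, ?_, hDn⟩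
  · rw [← hT]
    intro x hxT
    have h1 := (hTm x).mp hxT
    by_cases h2 : (Af α S).eval x = 0
    · rw [hA0 x h1 h2]
      refine mul_nonneg ?_ hder0.le
      have : B₁.eval 0 = a * B.eval 0 := by
        rw [hB₁]
        simp only [eval_add, eval_mul, eval_X, zero_mul, add_zero, eval_C,
          eval_one, Af_eval_mem α S 0 h0S, zero_add, mul_one]
      rw [this]
      exact mul_nonneg ha (eval_nonneg_of_coeff B pB.1 0 le_rfl)
    · have h3 := hDn x (hTle x hxT)
      rw [h1, zero_mul, sub_zero] at h3
      have h4 := mul_nonneg h3 (hpos x h1 h2).le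
      have h5 : 0 < (Af α S).eval x ^ 2 := by positivity
      refine nonneg_of_mul_nonneg_left ?_ h5
      linarith
  · rw [← hT]
    intro x hxT
    have h1 := (hTm x).mp hxT
    by_cases h2 : (Af α S).eval x = 0
    · rw [h2, zero_mul]
    · have := hpos x h1 h2
      linarith
  · rw [← hT]
    exact hder0

lemma DInv_all (a : ℝ) (ha : 0 ≤ a) (ha1 : a < 1) (m : ℕ) : DInv a m := by
  induction m with
  | zero => exact DInv_base a ha ha1
  | succ m ih => exact DInv_step a ha ha1 m ih

/-- main complex analytic input -/
lemma uhp_ne (a : ℝ) (ha : 0 ≤ a) (ha1 : a < 1) (m : ℕ) (z : ℂ) (hz : 0 < z.im) :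
    ∃ A R : ℂ, A ≠ 0 ∧ aeval z (AB a (m + 2)).1 = A ∧ aeval z (AB a (m + 2)).2 = A * R ∧
      R.im ≤ 0 ∧ 0 ≤ (z * R).im := by
  obtain ⟨α, S, hα, hcard, h0S, hS, hA, hsB, hsA₀, hd0, hD⟩ := DInv_all a ha ha1 m
  obtain ⟨-, gB⟩ := Gam_AB a ha ha1.le (m + 2)
  have pB := gB.props
  obtain ⟨β, c, hβ, hc, hB⟩ := pf_nonneg α hα S _ pB.1
    (fun k hk => pB.2.1 k (by omega)) hsB
  refine ⟨aeval z (Af α S), β + ∑ θ ∈ S, (c θ : ℂ) * (z - θ)⁻¹, aeval_Af_ne α hα.ne' S z hz,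
    by rw [hA], ?_, ?_, ?_⟩
  · rw [hB, map_add, map_mul, map_sum, mul_add, Finset.mul_sum]
    congr 1
    · rw [aeval_C, Complex.coe_algebraMap, mul_comm]
    · refine Finset.sum_congr rfl fun θ hθ => ?_
      rw [map_mul, aeval_Lf α S θ hθ z hz, aeval_C, Complex.coe_algebraMap]
      ring
  · simp only [Complex.add_im, Complex.im_sum, Complex.im_ofReal_mul, Complex.ofReal_im, zero_add]
    exact Finset.sum_nonpos fun θ hθ =>
      mul_nonpos_of_nonneg_of_nonpos (hc θ hθ) (inv_im_neg z θ hz)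
  · have : z * (β + ∑ θ ∈ S, (c θ : ℂ) * (z - θ)⁻¹)
        = β * z + ∑ θ ∈ S, (c θ : ℂ) * (1 + θ * (z - θ)⁻¹) := by
      rw [mul_add, Finset.mul_sum]
      congr 1
      · ring
      · refine Finset.sum_congr rfl fun θ hθ => ?_
        have h : z - θ ≠ 0 := by
          intro h
          have := congrArg Complex.im h
          simp at this
          linarith
        field_simp
        ring
    rw [this]
    simp only [Complex.add_im, Complex.im_sum, Complex.im_ofReal_mul, Complex.one_im, zero_add]
    refine add_nonneg (mul_nonneg hβ hz.le) (Finset.sum_nonneg fun θ hθ => ?_)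
    exact mul_nonneg (hc θ hθ)
      (mul_nonneg_of_nonpos_of_nonpos (hS θ hθ) (inv_im_neg z θ hz))

lemma final_ne (a : ℝ) (ha : 0 ≤ a) (z R : ℂ) (hz : 0 < z.im) (h1 : R.im ≤ 0)
    (h2 : 0 ≤ (z * R).im) :
    (1 + a * (z * R)) + Complex.I * (1 + a * R) ≠ 0 ∧ 1 + a * (z * R) ≠ 0 := by
  obtain ⟨x, y⟩ := z
  obtain ⟨u, v⟩ := R
  simp only [Complex.mul_im] at h1 h2 hz
  have key : 0 ≤ (a * v) * (1 + a * (x * u - y * v)) - (1 + a * u) * (a * (x * v + y * u)) →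
      a * u = 0 ∧ a * v = 0 := by
    intro h
    have e : (a * v) * (1 + a * (x * u - y * v)) - (1 + a * u) * (a * (x * v + y * u))
        = a * v - a * (x * v + y * u) - ((a * u) ^ 2 + (a * v) ^ 2) * y := by ring
    rw [e] at h
    have e1 := mul_nonneg ha h2
    have e2 := mul_nonneg ha (neg_nonneg.mpr h1)
    have e3 : ((a * u) ^ 2 + (a * v) ^ 2) * y ≤ 0 := by linarith
    have e4 : (a * u) ^ 2 + (a * v) ^ 2 ≤ 0 := nonpos_of_mul_nonpos_left e3 hz
    constructor <;> nlinarith [sq_nonneg (a * u), sq_nonneg (a * v)]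
  constructor
  · intro h
    have hr := congrArg Complex.re h
    have hi := congrArg Complex.im h
    simp at hr hi
    have hr' : a * v = 1 + a * (x * u - y * v) := by linarith
    have hi' : 1 + a * u = - (a * (x * v + y * u)) := by linarith
    obtain ⟨k1, k2⟩ := key (by
      rw [hi', ← hr']
      nlinarith [sq_nonneg (a * v), sq_nonneg (a * (x * v + y * u))])
    have : 1 + x * (a * u) - y * (a * v) - a * v = 0 := by linarith
    rw [k1, k2] at this
    simp at this
  · intro h
    have hr := congrArg Complex.re h
    have hi := congrArg Complex.im h
    simp at hr hi
    have hi' : a * (x * v + y * u) = 0 := by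
      rcases hi with hi | hi <;> simp [hi]
    obtain ⟨k1, k2⟩ := key (by rw [hr, hi']; simp)
    have : 1 + x * (a * u) - y * (a * v) = 0 := by linarith
    rw [k1, k2] at this
    simp at this

lemma main_ne (a : ℝ) (ha : 0 ≤ a) (ha1 : a < 1) (m : ℕ) (z : ℂ) (hz : 0 < z.im) :
    aeval z (pC a (m + 2)) + Complex.I * aeval z (reflect (m + 2) (pC a (m + 2))) ≠ 0 ∧
    aeval z (pC a (m + 2)) ≠ 0 := by
  obtain ⟨A, R, hA, e1, e2, h1, h2⟩ := uhp_ne a ha ha1 m z hz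
  obtain ⟨k1, k2⟩ := final_ne a ha z R hz h1 h2
  rw [reflect_pC a ha ha1.le (m + 2) (by omega), pC_eq_AB]
  simp only [map_add, map_mul, aeval_C, aeval_X, Complex.coe_algebraMap, e1, e2]
  constructor
  · intro h
    apply mul_ne_zero hA k1
    linear_combination h
  · intro h
    apply mul_ne_zero hA k2
    linear_combination h
/-- for all positive integers `n` and `r`, the colored derangement
polynomial `d_{n,r}` satisfies `I_n(d_{n,r}) ≺ d_{n,r}`; in particular it is
real-rooted and alternatingly increasing. -/
theorem stmt16 (n r : ℕ) (hn : 1 ≤ n) (hr : 1 ≤ r) :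
    Interlaces (Polynomial.reflect n (coloredDerangement n r)) (coloredDerangement n r) ∧
    RealRooted (coloredDerangement n r) ∧ AltInc n (coloredDerangement n r) := by
  have hr0 : (0 : ℝ) < r := by exact_mod_cast hr
  have hr1 : (1 : ℝ) ≤ r := by exact_mod_cast hr
  have ha : 0 ≤ ((r : ℝ) - 1) / r := div_nonneg (by linarith) hr0.le
  have ha1 : ((r : ℝ) - 1) / r < 1 := by
    rw [div_lt_one hr0]
    linarith
  have hc : 0 < (r : ℝ) ^ n := by positivity
  rw [coloredDerangement_eq n r hr]
  generalize ((r : ℝ) - 1) / r = a at ha ha1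
  generalize (r : ℝ) ^ n = c at hc
  refine ⟨?_, ?_, pC_altInc a ha ha1.le n hn c hc.le⟩
  · unfold Interlaces StableC toC
    rw [reflect_C_mul]
    rcases Nat.lt_or_ge n 2 with h | h
    · obtain rfl : n = 1 := by omega
      rw [reflect_pC a ha ha1.le 1 le_rfl, pC_one]
      rcases eq_or_ne a 0 with rfl | ha0
      · left
        simp [AB]
      · right
        intro z hz h0
        simp [AB, hc.ne'] at h0
        have : (c : ℂ) * a * (z + Complex.I) = 0 := by linear_combination h0
        have hca : (c : ℂ) * a ≠ 0 := by
          exact_mod_cast mul_ne_zero hc.ne' ha0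
        have h3 := congrArg Complex.im ((mul_eq_zero.mp this).resolve_left hca)
        simp at h3
        linarith
    · obtain ⟨m, rfl⟩ : ∃ m, n = m + 2 := ⟨n - 2, by omega⟩
      right
      intro z hz h0
      have hm := (main_ne a ha ha1 m z hz).1
      rw [eval_add, eval_mul, eval_C, eval_map_algebraMap, eval_map_algebraMap, map_mul, map_mul,
        aeval_C, Complex.coe_algebraMap] at h0
      refine mul_ne_zero (by exact_mod_cast hc.ne') hm (?_ : (c : ℂ) * _ = 0)
      linear_combination h0
  · unfold RealRooted toC
    rcases Nat.lt_or_ge n 2 with h | h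
    · obtain rfl : n = 1 := by omega
      rw [pC_one]
      rcases eq_or_ne a 0 with rfl | ha0
      · left
        simp
      · right
        intro z hz
        simp [hc.ne', ha0] at hz
        simp [hz]
    · obtain ⟨m, rfl⟩ : ∃ m, n = m + 2 := ⟨n - 2, by omega⟩
      right
      intro z hz
      refine aeval_conj_zero (pC a (m + 2)) (fun w hw => (main_ne a ha ha1 m w hw).2) z ?_
      rw [eval_map_algebraMap, map_mul, aeval_C, Complex.coe_algebraMap] at hz
      exact (mul_eq_zero.mp hz).resolve_left (by exact_mod_cast hc.ne')
end

section
/- For all positive integers n and r, the I_n-decomposition (a, b) of the colored derangement polynomial d_{n,r} is real-rooted, i.e., both a and b are real-rooted polynomials. -/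
open Polynomial
open scoped Classical

namespace Stmt17Aux

/-- Weight of the index `i` of a permutation. -/
def wt {α : Type} [LinearOrder α] (ρ w x : ℂ) (σ : Equiv.Perm α) (i : α) : ℂ :=
  if σ i = i then w else if i < σ i then ρ * x else ρ

/-- Weighted sum over all permutations. -/
def G (n : ℕ) (ρ w x : ℂ) : ℂ := ∑ σ : Equiv.Perm (Fin n), ∏ i, wt ρ w x σ i

lemma G_order {α : Type} [LinearOrder α] [Fintype α] {m : ℕ} (e : Fin m ≃o α) (ρ w x : ℂ) :
    ∑ σ : Equiv.Perm α, ∏ i, wt ρ w x σ i = G m ρ w x := by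
  unfold G
  symm
  refine Fintype.sum_equiv (Equiv.permCongr e.toEquiv) _ _ ?_
  intro σ
  refine Fintype.prod_equiv e.toEquiv _ _ ?_
  intro i
  simp [wt, Equiv.permCongr_apply]

lemma inner (n : ℕ) (x : ℂ) (S : Finset (Fin n)) :
    ∑ σ : Equiv.Perm (Fin n), (∏ i ∈ S, (if σ i = i then (1:ℂ) else 0)) *
      ∏ i ∈ Finset.univ \ S, wt 1 0 x σ i = G (n - S.card) 1 0 x := by
  have hc : (Finset.univ \ S).card = n - S.card := by
    rw [Finset.card_sdiff_of_subset (Finset.subset_univ _)]; simp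
  rw [← G_order (Finset.orderIsoOfFin (Finset.univ \ S) hc)]
  have h1 : ∀ σ : Equiv.Perm (Fin n), (∏ i ∈ S, (if σ i = i then (1:ℂ) else 0)) *
      ∏ i ∈ Finset.univ \ S, wt 1 0 x σ i =
      if (∀ a, ¬ (a ∈ Finset.univ \ S) → σ a = a) then ∏ i ∈ Finset.univ \ S, wt 1 0 x σ i else 0 := by
    intro σ
    split_ifs with h
    · rw [Finset.prod_eq_one, one_mul]
      intro i hi
      rw [if_pos]
      exact h i (by simpa using hi)
    · push Not at h
      obtain ⟨a, ha, hne⟩ := h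
      rw [Finset.prod_eq_zero (i := a) (by simpa using ha) (by simp [hne]), zero_mul]
  simp_rw [h1]
  rw [← Finset.sum_filter]
  rw [Finset.sum_subtype (p := fun σ : Equiv.Perm (Fin n) => ∀ a, ¬ (a ∈ Finset.univ \ S) → σ a = a)
    (Finset.univ.filter (fun σ : Equiv.Perm (Fin n) => ∀ a, ¬ (a ∈ Finset.univ \ S) → σ a = a))
    (by intro σ; simp) (fun σ => ∏ i ∈ Finset.univ \ S, wt 1 0 x σ i)]
  rw [← Equiv.sum_comp (Equiv.Perm.subtypeEquivSubtypePerm (fun a => a ∈ Finset.univ \ S))]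
  refine Finset.sum_congr (by ext; simp) ?_
  intro σ _
  rw [← Finset.prod_coe_sort (Finset.univ \ S) (fun i => wt 1 0 x _ i)]
  refine Finset.prod_congr rfl ?_
  intro i _
  have h2 := Equiv.Perm.subtypeEquivSubtypePerm_apply_of_mem (p := fun a => a ∈ Finset.univ \ S) σ i.2
  simp only [wt]
  rw [h2]
  simp only [Subtype.coe_eta, Subtype.coe_lt_coe, Subtype.coe_inj]
  congr

lemma G_expand (n : ℕ) (ρ w x : ℂ) :
    G n ρ w x = ∑ j ∈ Finset.range (n + 1), (n.choose j : ℂ) * (w ^ j * ρ ^ (n - j) * G (n - j) 1 0 x) := by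
  have h1 : ∀ σ : Equiv.Perm (Fin n), ∏ i, wt ρ w x σ i =
      ∑ S ∈ (Finset.univ : Finset (Fin n)).powerset, w ^ S.card * ρ ^ (n - S.card) *
        ((∏ i ∈ S, (if σ i = i then (1:ℂ) else 0)) * ∏ i ∈ Finset.univ \ S, wt 1 0 x σ i) := by
    intro σ
    have : ∀ i, wt ρ w x σ i = w * (if σ i = i then (1:ℂ) else 0) + ρ * wt 1 0 x σ i := by
      intro i
      unfold wt
      split_ifs <;> simp
    simp_rw [this]
    rw [Finset.prod_add]
    refine Finset.sum_congr rfl ?_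
    intro S _
    have hc : (Finset.univ \ S).card = n - S.card := by
      rw [Finset.card_sdiff_of_subset (Finset.subset_univ _)]; simp
    rw [Finset.prod_mul_distrib, Finset.prod_mul_distrib, Finset.prod_const, Finset.prod_const, hc]
    ring
  unfold G
  simp_rw [h1]
  rw [Finset.sum_comm]
  simp_rw [← Finset.mul_sum, inner]
  rw [Finset.sum_powerset_apply_card (fun j => w ^ j * ρ ^ (n - j) * G (n - j) 1 0 x)]
  simp [G]

lemma G_rot (m : ℕ) (x : ℂ) : G (m + 1) 1 x x = x * G (m + 1) 1 1 x := by
  unfold G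
  rw [Finset.mul_sum]
  refine Fintype.sum_equiv (Equiv.mulRight (finRotate (m + 1))) _ _ ?_
  intro σ
  rw [Fin.prod_univ_succ, Fin.prod_univ_castSucc]
  have hl : wt 1 1 x ((Equiv.mulRight (finRotate (m + 1))) σ) (Fin.last m) = 1 := by
    unfold wt
    have : ¬ (Fin.last m < ((Equiv.mulRight (finRotate (m + 1))) σ) (Fin.last m)) :=
      not_lt.mpr (Fin.le_last _)
    rw [if_neg this]; simp
  have h0 : wt 1 x x σ 0 = x := by
    unfold wt
    split_ifs with h h'
    · rfl
    · simp
    · exact absurd (Fin.pos_iff_ne_zero.mpr h) h'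
  rw [hl, h0, mul_one]
  congr 1
  refine Finset.prod_congr rfl ?_
  intro i _
  have hr : ((Equiv.mulRight (finRotate (m + 1))) σ) i.castSucc = σ i.succ := by
    simp
  unfold wt
  rw [hr]
  have h := @Fin.castSucc_lt_iff_succ_le m i (σ i.succ)
  simp only [h]
  rcases lt_trichotomy (σ i.succ) i.succ with h1 | h1 | h1
  · simp [h1.ne, not_le.mpr h1, not_lt.mpr h1.le]
  · have h2 : i.succ ≠ i.castSucc := (Fin.castSucc_lt_succ).ne'
    simp [h1, h2]
  · have h2 : σ i.succ ≠ i.castSucc := (lt_trans (Fin.castSucc_lt_succ) h1).ne'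
    simp [h1, h1.ne', h1.le, h2]

lemma G_zero (ρ w x : ℂ) : G 0 ρ w x = 1 := by
  simp [G]

lemma coloredDerangement_eval (n r : ℕ) (hr : 1 ≤ r) (x : ℂ) :
    (toC (coloredDerangement n r)).eval x = G n r ((r - 1) * x) x := by
  unfold toC coloredDerangement G
  rw [Polynomial.map_sum, Polynomial.eval_finsetSum]
  refine Finset.sum_congr rfl ?_
  intro σ _
  rw [Polynomial.map_sum, Polynomial.eval_finsetSum]
  have h1 : ∀ i, wt (r:ℂ) ((r-1) * x) x σ i = ∑ c ∈ (Finset.univ : Finset (Fin r)),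
      (if σ i = i then (if (c:ℕ) = 0 then 0 else x) else if i < σ i then x else 1) := by
    intro i
    unfold wt
    split_ifs with h h'
    · obtain ⟨s, rfl⟩ : ∃ s, r = s + 1 := ⟨r - 1, by omega⟩
      rw [Fin.sum_univ_succ]
      simp
    · simp
    · simp
  simp_rw [h1]
  rw [Finset.prod_univ_sum, Fintype.piFinset_univ, Finset.sum_filter]
  refine Finset.sum_congr rfl ?_
  intro z _
  split_ifs with h
  · rw [Polynomial.map_pow, Polynomial.map_X, Polynomial.eval_pow, Polynomial.eval_X]
    unfold excC
    rw [Finset.card_eq_sum_ones, Finset.sum_filter, ← Finset.prod_pow_eq_pow_sum]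
    refine Finset.prod_congr rfl ?_
    intro i _
    have := h i
    by_cases h1 : σ i = i
    · have h2 : (z i : ℕ) ≠ 0 := fun h2 => this ⟨h1, h2⟩
      simp [h1, h2, Nat.pos_of_ne_zero h2]
    · by_cases h2 : i < σ i <;> simp [h1, h2]
  · push Not at h
    obtain ⟨k, hk, hk'⟩ := h
    rw [Finset.prod_eq_zero (i := k) (Finset.mem_univ _)]
    simp [hk, hk']

lemma G_flip (n : ℕ) (ρ w x : ℂ) (hx : x ≠ 0) :
    x ^ n * G n ρ (w * x⁻¹) x⁻¹ = G n ρ w x := by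
  unfold G
  rw [Finset.mul_sum]
  refine Fintype.sum_equiv (Equiv.inv (Equiv.Perm (Fin n))) _ _ ?_
  intro σ
  have : x ^ n = ∏ i : Fin n, x := by simp
  rw [this, ← Finset.prod_mul_distrib]
  refine Fintype.prod_equiv σ _ _ ?_
  intro i
  unfold wt
  have hi : (Equiv.inv (Equiv.Perm (Fin n)) σ) (σ i) = i := by simp
  rw [hi]
  rcases lt_trichotomy (σ i) i with h | h | h
  · simp [h, h.ne, h.ne', not_lt.mpr h.le, mul_comm]
  · simp [h]; field_simp
  · simp [h, h.ne, h.ne', not_lt.mpr h.le]; field_simp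

/-- The umbral functional of the derangement polynomials. -/
noncomputable def psi (x : ℂ) : ℂ[X] →ₗ[ℂ] ℂ := (Polynomial.basisMonomials ℂ).constr ℂ (fun n => G n 1 0 x)

lemma psi_X_pow (x : ℂ) (n : ℕ) : psi x (X ^ n) = G n 1 0 x := by
  have := (Polynomial.basisMonomials ℂ).constr_basis ℂ (fun n => G n 1 0 x) n
  rw [Polynomial.coe_basisMonomials] at this
  beta_reduce at this
  rwa [Polynomial.monomial_one_right_eq_X_pow] at this

lemma psi_C_mul (x c : ℂ) (g : ℂ[X]) : psi x (C c * g) = c * psi x g := by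
  rw [← Polynomial.smul_eq_C_mul, map_smul, smul_eq_mul]

lemma psi_lin_pow (x w ρ : ℂ) (n : ℕ) : psi x ((C w + C ρ * X) ^ n) = G n ρ w x := by
  rw [add_pow, map_sum, G_expand]
  refine Finset.sum_congr rfl ?_
  intro j _
  have : (C w) ^ j * (C ρ * X) ^ (n - j) * ((n.choose j : ℕ) : ℂ[X]) =
      C ((n.choose j : ℂ) * (w ^ j * ρ ^ (n - j))) * X ^ (n - j) := by
    rw [mul_pow]
    simp only [map_mul, map_pow, map_natCast]
    ring
  rw [this, psi_C_mul, psi_X_pow]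
  ring

lemma psi_key (x : ℂ) (g : ℂ[X]) :
    x * psi x (g.comp (X + 1)) = psi x (g.comp (X + C x)) - (1 - x) * g.eval 0 := by
  induction g using Polynomial.induction_on' with
  | add p q hp hq =>
    simp only [Polynomial.add_comp, map_add, Polynomial.eval_add]
    linear_combination hp + hq
  | monomial n c =>
    rw [← Polynomial.C_mul_X_pow_eq_monomial]
    simp only [Polynomial.mul_comp, Polynomial.C_comp, Polynomial.X_pow_comp, psi_C_mul,
      Polynomial.eval_mul, Polynomial.eval_C, Polynomial.eval_pow, Polynomial.eval_X]
    have h1 := psi_lin_pow x 1 1 n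
    have h2 := psi_lin_pow x x 1 n
    have e1 : (X + 1 : ℂ[X]) = C 1 + C 1 * X := by simp [add_comm]
    have e2 : (X + C x : ℂ[X]) = C x + C 1 * X := by simp [add_comm]
    rw [e1, e2, h1, h2]
    cases n with
    | zero => simp [G_zero]; ring
    | succ m => rw [G_rot]; simp; ring

/-- The umbral functional of the colored derangement polynomials. -/
noncomputable def phi (x ρ : ℂ) : ℂ[X] →ₗ[ℂ] ℂ :=
  psi x ∘ₗ (Polynomial.aeval (C ((ρ - 1) * x) + C ρ * X : ℂ[X])).toLinearMap

lemma phi_C_mul (x ρ c : ℂ) (g : ℂ[X]) : phi x ρ (C c * g) = c * phi x ρ g := by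
  rw [← Polynomial.smul_eq_C_mul, map_smul, smul_eq_mul]

lemma phi_pow (x ρ c : ℂ) (n : ℕ) :
    phi x ρ ((X + C c) ^ n) = G n ρ ((ρ - 1) * x + c) x := by
  rw [← psi_lin_pow]
  unfold phi
  simp only [LinearMap.comp_apply, AlgHom.toLinearMap_apply, map_pow, map_add,
    Polynomial.aeval_X, Polynomial.aeval_C, Polynomial.algebraMap_eq]
  congr 2
  ring

lemma phi_boundary (x ρ : ℂ) (n : ℕ) :
    x * phi x ρ ((X + C (ρ * (1 - x))) ^ n) = phi x ρ ((X + C 0) ^ n) - (1 - x) * (-x) ^ n := by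
  rw [phi_pow, phi_pow]
  have h := psi_key x ((C ρ * X - C x) ^ n)
  simp only [Polynomial.pow_comp, Polynomial.sub_comp, Polynomial.mul_comp, Polynomial.C_comp,
    Polynomial.X_comp] at h
  have e1 : (C ρ * (X + 1) - C x : ℂ[X]) = C (ρ - x) + C ρ * X := by
    simp only [map_sub]; ring
  have e2 : (C ρ * (X + C x) - C x : ℂ[X]) = C ((ρ - 1) * x) + C ρ * X := by
    simp only [map_sub, map_mul, map_one]; ring
  rw [e1, e2, psi_lin_pow, psi_lin_pow] at h
  have e3 : (ρ - 1) * x + ρ * (1 - x) = ρ - x := by ring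
  rw [e3, h]
  simp

/-- Shifted variable. -/
noncomputable def Y (x : ℂ) (k : ℕ) : ℂ[X] := X + C ((k : ℂ) * (1 - x))

/-- The polynomials representing the refined colored derangement polynomials. -/
noncomputable def QP (x : ℂ) (n k l : ℕ) : ℂ[X] :=
  if l = 0 then Y x k ^ n else Y x k ^ (n - l) * Y x (k + 1) ^ (l - 1) * (Y x k + 1)

/-- Antidifference of `QP`. -/
noncomputable def PsiP (x : ℂ) (m k l : ℕ) : ℂ[X] :=
  if l = 0 then Y x k ^ (m + 1) + C x * Y x k ^ m else QP x (m + 1) k l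

lemma Y_succ (x : ℂ) (k : ℕ) : Y x (k + 1) = Y x k + 1 - C x := by
  unfold Y
  push_cast
  simp only [map_mul, map_add, map_sub, map_one]
  ring

lemma PsiP_step (x : ℂ) (m k l : ℕ) (hl : l ≤ m) :
    PsiP x m k (l + 1) = PsiP x m k l + C (1 - x) * QP x m k l := by
  rcases l with _ | l
  · simp only [PsiP, QP, map_sub, map_one]
    simp
    ring
  · obtain ⟨e, rfl⟩ : ∃ e, m = l + 1 + e := ⟨m - (l + 1), by omega⟩
    have e1 : l + 1 + e + 1 - (l + 1 + 1) = e := by omega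
    have e2 : l + 1 + e + 1 - (l + 1) = e + 1 := by omega
    have e3 : l + 1 + e - (l + 1) = e := by omega
    simp only [PsiP, QP, Nat.add_eq_zero_iff, one_ne_zero, and_false, if_false, e1, e2, e3,
      Nat.add_sub_cancel, map_sub, map_one, Y_succ]
    ring

lemma PsiP_wrap (x : ℂ) (m k : ℕ) : PsiP x m k (m + 1) = PsiP x m (k + 1) 0 := by
  simp only [PsiP, QP, Nat.add_eq_zero_iff, one_ne_zero, and_false, if_false,
      Nat.add_sub_cancel, Nat.sub_self, if_true, Y_succ]
  ring

/-- Refined colored derangement polynomials (evaluated at `x`), with index `j < r (n+1)`. -/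
noncomputable def Q (x : ℂ) (r n j : ℕ) : ℂ := phi x r (QP x n (j / (n + 1)) (j % (n + 1)))

lemma Q_sum (x : ℂ) (r m k : ℕ) : ∀ l, l ≤ m + 1 →
    (1 - x) * ∑ i ∈ Finset.range ((m + 1) * k + l), Q x r m i =
      phi x r (PsiP x m k l) - phi x r (PsiP x m 0 0) := by
  have step : ∀ k l, l ≤ m → (1 - x) * Q x r m ((m + 1) * k + l) =
      phi x r (PsiP x m k (l + 1)) - phi x r (PsiP x m k l) := by
    intro k l hl
    rw [PsiP_step x m k l hl, map_add, phi_C_mul]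
    unfold Q
    have h1 : ((m + 1) * k + l) / (m + 1) = k := by
      rw [Nat.mul_add_div (by omega), Nat.div_eq_of_lt (by omega), add_zero]
    have h2 : ((m + 1) * k + l) % (m + 1) = l := by
      rw [Nat.mul_add_mod, Nat.mod_eq_of_lt (by omega)]
    rw [h1, h2]
    ring
  have inner : ∀ k, (1 - x) * ∑ i ∈ Finset.range ((m + 1) * k), Q x r m i =
      phi x r (PsiP x m k 0) - phi x r (PsiP x m 0 0) → ∀ l, l ≤ m + 1 →
    (1 - x) * ∑ i ∈ Finset.range ((m + 1) * k + l), Q x r m i =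
      phi x r (PsiP x m k l) - phi x r (PsiP x m 0 0) := by
    intro k hk l
    induction l with
    | zero => intro _; simpa using hk
    | succ l ih =>
      intro hl
      rw [← add_assoc, Finset.sum_range_succ, mul_add, ih (by omega), step k l (by omega)]
      ring
  induction k with
  | zero => exact inner 0 (by simp)
  | succ k ih =>
    refine inner (k + 1) ?_
    have := ih (m + 1) le_rfl
    rw [PsiP_wrap] at this
    rw [mul_add, mul_one]
    exact this

lemma Q_total (x : ℂ) (hx : 1 - x ≠ 0) (r m : ℕ) :
    x * ∑ i ∈ Finset.range ((m + 1) * r), Q x r m i = phi x r (PsiP x m 0 0) := by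
  have h := Q_sum x r m r 0 (by omega)
  rw [add_zero] at h
  have h1 := phi_boundary x r (m + 1)
  have h2 := phi_boundary x r m
  have hb : x * phi x r (PsiP x m r 0) = phi x r (PsiP x m 0 0) := by
    simp only [PsiP, if_true, map_add, phi_C_mul, Y, Nat.cast_zero, zero_mul]
    linear_combination h1 + x * h2
  apply mul_left_cancel₀ hx
  linear_combination x * h + hb

/-- Row sums. -/
noncomputable def R (x : ℂ) (f : ℕ → ℂ) (N s t : ℕ) : ℂ :=
  ∑ i ∈ Finset.range s, f i + x * ∑ i ∈ Finset.Ico t N, f i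

lemma Q_row (x : ℂ) (hx : 1 - x ≠ 0) (r m k l : ℕ) (hl : l ≤ m + 1) (h : (m + 1) * k + l ≤ (m + 1) * r) :
    R x (Q x r m) ((m + 1) * r) ((m + 1) * k + l) ((m + 1) * k + l) = phi x r (PsiP x m k l) := by
  have h1 := Q_sum x r m k l hl
  have h2 := Q_total x hx r m
  have h3 := Finset.sum_range_add_sum_Ico (Q x r m) h
  unfold R
  linear_combination h1 + h2 + x * h3

/-- Row start. -/
noncomputable def sI (m j : ℕ) : ℕ := (m + 1) * (j / (m + 2)) + j % (m + 2)

/-- Row restart. -/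
noncomputable def tI (m j : ℕ) : ℕ := sI m j + if j % (m + 2) = 0 then 1 else 0

lemma sI_le (m j r : ℕ) (hj : j < (m + 2) * r) : tI m j ≤ (m + 1) * r := by
  unfold tI sI
  have h1 : j / (m + 2) < r := Nat.div_lt_of_lt_mul hj
  have h2 : j % (m + 2) < m + 2 := Nat.mod_lt _ (by omega)
  generalize j / (m + 2) = k at *
  generalize j % (m + 2) = l at *
  obtain ⟨e, rfl⟩ : ∃ e, r = k + 1 + e := ⟨r - (k + 1), by omega⟩
  have : (m + 1) * (k + 1 + e) = (m + 1) * k + (m + 1) + (m + 1) * e := by ring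
  rw [this]
  generalize (m + 1) * e = e'
  split_ifs <;> omega

lemma tI_le_sI (m i j : ℕ) (h : i < j) : tI m i ≤ sI m j := by
  unfold tI sI
  have hi := Nat.div_add_mod i (m + 2)
  have hj := Nat.div_add_mod j (m + 2)
  have hk : i / (m + 2) ≤ j / (m + 2) := Nat.div_le_div_right h.le
  have h1 : i % (m + 2) < m + 2 := Nat.mod_lt _ (by omega)
  generalize i / (m + 2) = k at *
  generalize i % (m + 2) = l at *
  generalize j / (m + 2) = k' at *
  generalize j % (m + 2) = l' at *
  obtain ⟨e, rfl⟩ : ∃ e, k' = k + e := ⟨k' - k, by omega⟩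
  rcases e with _ | e
  · simp only [add_zero] at *
    split_ifs <;> omega
  · have : (m + 1) * (k + (e + 1)) = (m + 1) * k + (m + 1) + (m + 1) * e := by ring
    rw [this]
    generalize (m + 1) * e = e'
    split_ifs <;> omega

lemma Q_rec (x : ℂ) (hx : 1 - x ≠ 0) (r m j : ℕ) (hj : j < (m + 2) * r) :
    Q x r (m + 1) j = R x (Q x r m) ((m + 1) * r) (sI m j) (tI m j) := by
  have hle := sI_le m j r hj
  have hl : j % (m + 2) ≤ m + 1 := by have := Nat.mod_lt j (show 0 < m + 2 by omega); omega
  have h0 : sI m j ≤ (m + 1) * r := le_trans (by unfold tI; omega) hle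
  have hrow := Q_row x hx r m (j / (m + 2)) (j % (m + 2)) hl h0
  change R x (Q x r m) ((m + 1) * r) (sI m j) (sI m j) = _ at hrow
  have hQ : Q x r (m + 1) j = phi x r (QP x (m + 1) (j / (m + 2)) (j % (m + 2))) := rfl
  rw [hQ]
  by_cases hz : j % (m + 2) = 0
  · have ht : tI m j = sI m j + 1 := by simp [tI, hz]
    rw [ht] at hle ⊢
    have hs : sI m j = (m + 1) * (j / (m + 2)) := by simp [sI, hz]
    have hf : Q x r m (sI m j) = phi x r (Y x (j / (m + 2)) ^ m) := by
      unfold Q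
      rw [hs, Nat.mul_div_cancel_left _ (by omega), Nat.mul_mod_right]
      simp [QP]
    rw [hz] at hrow ⊢
    simp only [PsiP, QP, if_true, map_add, phi_C_mul] at hrow ⊢
    rw [← hf] at hrow
    have h3 := Finset.sum_eq_sum_Ico_succ_bot (show sI m j < (m + 1) * r by omega) (Q x r m)
    unfold R at hrow ⊢
    linear_combination -hrow + x * h3
  · have ht : tI m j = sI m j := by simp [tI, hz]
    rw [ht, hrow]
    simp [PsiP, hz]

/-- Pointwise interlacing relation. -/
def P (x a b : ℂ) : Prop :=
  0 ≤ (a * (starRingEnd ℂ) b).im ∧ 0 ≤ (x * b * (starRingEnd ℂ) a).im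

lemma P_sum_left (x b : ℂ) (f : ℕ → ℂ) (S : Finset ℕ) (h : ∀ i ∈ S, P x (f i) b) :
    P x (∑ i ∈ S, f i) b := by
  constructor
  · rw [Finset.sum_mul, Complex.im_sum]
    exact Finset.sum_nonneg fun i hi => (h i hi).1
  · rw [map_sum, Finset.mul_sum, Complex.im_sum]
    exact Finset.sum_nonneg fun i hi => (h i hi).2

lemma P_sum_right (x b : ℂ) (f : ℕ → ℂ) (S : Finset ℕ) (h : ∀ i ∈ S, P x b (f i)) :
    P x b (∑ i ∈ S, f i) := by
  constructor
  · rw [map_sum, Finset.mul_sum, Complex.im_sum]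
    exact Finset.sum_nonneg fun i hi => (h i hi).1
  · rw [Finset.mul_sum, Finset.sum_mul, Complex.im_sum]
    exact Finset.sum_nonneg fun i hi => (h i hi).2

/-- Pointwise interlacing sequence. -/
def Wseq (x : ℂ) (f : ℕ → ℂ) (N : ℕ) : Prop := ∀ i j, i < j → j < N → P x (f i) (f j)

lemma P_blocks {x : ℂ} {f : ℕ → ℂ} {N : ℕ} (h : Wseq x f N) {a b c d : ℕ} (hbc : b ≤ c) (hd : d ≤ N) :
    P x (∑ i ∈ Finset.Ico a b, f i) (∑ i ∈ Finset.Ico c d, f i) := by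
  refine P_sum_left _ _ _ _ ?_
  intro i hi
  refine P_sum_right _ _ _ _ ?_
  intro j hj
  rw [Finset.mem_Ico] at hi hj
  exact h i j (by omega) (by omega)

lemma block (x A U B V C : ℂ) (hAU : P x A U) (hAB : P x A B) (hAV : P x A V)
    (hUB : P x U B) (hUV : P x U V) (hUC : P x U C) (hBV : P x B V) (hBC : P x B C) (hVC : P x V C) :
    x.im * Complex.normSq B ≤
      ((A + x * (B + V + C)) * (starRingEnd ℂ) (A + U + B + x * C)).im ∧
    x.im * Complex.normSq (A + x * C) ≤
      (x * (A + U + B + x * C) * (starRingEnd ℂ) (A + x * (B + V + C))).im := by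
  obtain ⟨hAU, hAU'⟩ := hAU
  obtain ⟨hAB, hAB'⟩ := hAB
  obtain ⟨hAV, hAV'⟩ := hAV
  obtain ⟨hUB, hUB'⟩ := hUB
  obtain ⟨hUV, hUV'⟩ := hUV
  obtain ⟨hUC, hUC'⟩ := hUC
  obtain ⟨hBV, hBV'⟩ := hBV
  obtain ⟨hBC, hBC'⟩ := hBC
  obtain ⟨hVC, hVC'⟩ := hVC
  have hn := Complex.normSq_nonneg x
  constructor
  · have e : ((A + x * (B + V + C)) * (starRingEnd ℂ) (A + U + B + x * C)).im =
        x.im * Complex.normSq B + (A * (starRingEnd ℂ) U).im + (A * (starRingEnd ℂ) B).im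
        + (x * B * (starRingEnd ℂ) A).im + (x * B * (starRingEnd ℂ) U).im
        + Complex.normSq x * (B * (starRingEnd ℂ) C).im
        + (x * V * (starRingEnd ℂ) A).im + (x * V * (starRingEnd ℂ) U).im
        + (x * V * (starRingEnd ℂ) B).im + Complex.normSq x * (V * (starRingEnd ℂ) C).im
        + (x * C * (starRingEnd ℂ) U).im + (x * C * (starRingEnd ℂ) B).im := by
      simp only [Complex.normSq_apply, Complex.mul_im, Complex.mul_re, Complex.add_re,
        Complex.add_im, Complex.conj_re, Complex.conj_im]
      ring
    rw [e]
    have := mul_nonneg hn hBC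
    have := mul_nonneg hn hVC
    linarith
  · have e : (x * (A + U + B + x * C) * (starRingEnd ℂ) (A + x * (B + V + C))).im =
        x.im * Complex.normSq (A + x * C)
        + Complex.normSq x * ((A * (starRingEnd ℂ) B).im + (A * (starRingEnd ℂ) V).im
          + (U * (starRingEnd ℂ) B).im + (U * (starRingEnd ℂ) V).im + (U * (starRingEnd ℂ) C).im
          + (B * (starRingEnd ℂ) V).im + (B * (starRingEnd ℂ) C).im
          + (x * C * (starRingEnd ℂ) B).im + (x * C * (starRingEnd ℂ) V).im)
        + (x * U * (starRingEnd ℂ) A).im + (x * B * (starRingEnd ℂ) A).im := by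
      simp only [Complex.normSq_apply, Complex.mul_im, Complex.mul_re, Complex.add_re,
        Complex.add_im, Complex.conj_re, Complex.conj_im]
      ring
    rw [e]
    have : 0 ≤ Complex.normSq x * ((A * (starRingEnd ℂ) B).im + (A * (starRingEnd ℂ) V).im
          + (U * (starRingEnd ℂ) B).im + (U * (starRingEnd ℂ) V).im + (U * (starRingEnd ℂ) C).im
          + (B * (starRingEnd ℂ) V).im + (B * (starRingEnd ℂ) C).im
          + (x * C * (starRingEnd ℂ) B).im + (x * C * (starRingEnd ℂ) V).im) := by positivity
    linarith

lemma rows {x : ℂ} {f : ℕ → ℂ} {N : ℕ} (h : Wseq x f N) {s t s' t' : ℕ}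
    (h1 : s ≤ t) (h2 : t ≤ s') (h3 : s' ≤ t') (h4 : t' ≤ N) :
    x.im * Complex.normSq (∑ i ∈ Finset.Ico t s', f i) ≤
      (R x f N s t * (starRingEnd ℂ) (R x f N s' t')).im ∧
    x.im * Complex.normSq (∑ i ∈ Finset.Ico 0 s, f i + x * ∑ i ∈ Finset.Ico t' N, f i) ≤
      (x * R x f N s' t' * (starRingEnd ℂ) (R x f N s t)).im := by
  have key := block x (∑ i ∈ Finset.Ico 0 s, f i) (∑ i ∈ Finset.Ico s t, f i)
    (∑ i ∈ Finset.Ico t s', f i) (∑ i ∈ Finset.Ico s' t', f i) (∑ i ∈ Finset.Ico t' N, f i)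
    (P_blocks h (by omega) (by omega)) (P_blocks h (by omega) (by omega))
    (P_blocks h (by omega) (by omega)) (P_blocks h (by omega) (by omega))
    (P_blocks h (by omega) (by omega)) (P_blocks h (by omega) (by omega))
    (P_blocks h (by omega) (by omega)) (P_blocks h (by omega) (by omega))
    (P_blocks h (by omega) (by omega))
  rw [Finset.sum_Ico_consecutive _ h2 h3, Finset.sum_Ico_consecutive _ (by omega) h4,
    Finset.sum_Ico_consecutive _ (by omega) h1, Finset.sum_Ico_consecutive _ (by omega) h2] at key
  simpa only [R, Finset.range_eq_Ico] using key

lemma Q_zero (x : ℂ) (r j : ℕ) : Q x r 0 j = 1 := by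
  have : phi x r ((X + C 0) ^ 0) = 1 := by rw [phi_pow, G_zero]
  rw [pow_zero] at this
  simp [Q, QP, Nat.mod_one, this]

lemma Q_W {x : ℂ} (hx : 0 < x.im) (r m : ℕ) : Wseq x (Q x r m) ((m + 1) * r) := by
  have hx1 : 1 - x ≠ 0 := by
    intro h
    have := congrArg Complex.im h
    simp at this
    exact hx.ne' this
  induction m with
  | zero =>
    intro i j _ _
    rw [Q_zero, Q_zero]
    simp [P, hx.le]
  | succ m ih =>
    intro i j hij hj
    have hj2 : j < (m + 2) * r := hj
    rw [Q_rec x hx1 r m i (lt_trans hij hj2), Q_rec x hx1 r m j hj2]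
    have := rows ih (s := sI m i) (t := tI m i) (s' := sI m j) (t' := tI m j)
      (by unfold tI; omega) (tI_le_sI m i j hij) (by unfold tI; omega) (sI_le m j r hj2)
    exact ⟨le_trans (mul_nonneg hx.le (Complex.normSq_nonneg _)) this.1,
      le_trans (mul_nonneg hx.le (Complex.normSq_nonneg _)) this.2⟩

lemma sum_zero {x : ℂ} (hx : 0 < x.im) {f : ℕ → ℂ} {N : ℕ} (h : Wseq x f N) (S : Finset ℕ) :
    (∀ i ∈ S, i < N) → ∑ i ∈ S, f i = 0 → ∀ i ∈ S, f i = 0 := by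
  induction S using Finset.induction_on_min with
  | empty => simp
  | insert a s ha ih =>
    intro hN hs
    have has : a ∉ s := fun h' => lt_irrefl _ (ha a h')
    rw [Finset.sum_insert has] at hs
    have hP : P x (f a) (∑ i ∈ s, f i) := by
      refine P_sum_right _ _ _ _ ?_
      intro i hi
      exact h a i (ha i hi) (hN i (Finset.mem_insert_of_mem hi))
    have hs' : ∑ i ∈ s, f i = - f a := by linear_combination hs
    have h2 := hP.2
    rw [hs'] at h2
    have e : (x * -f a * (starRingEnd ℂ) (f a)).im = - (x.im * Complex.normSq (f a)) := by
      simp only [Complex.normSq_apply, Complex.mul_im, Complex.mul_re, Complex.neg_re,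
        Complex.neg_im, Complex.conj_re, Complex.conj_im]
      ring
    rw [e] at h2
    have h3 : Complex.normSq (f a) = 0 := by
      have := Complex.normSq_nonneg (f a)
      nlinarith
    have h4 : f a = 0 := Complex.normSq_eq_zero.mp h3
    intro i hi
    rcases Finset.mem_insert.mp hi with rfl | hi
    · exact h4
    · exact ih (fun i hi => hN i (Finset.mem_insert_of_mem hi)) (by rw [hs', h4, neg_zero]) i hi

lemma one_sub_ne {x : ℂ} (hx : 0 < x.im) : 1 - x ≠ 0 := by
  intro h
  have := congrArg Complex.im h
  simp at this
  exact hx.ne' this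

lemma Q_last {x : ℂ} (hx : 0 < x.im) (r m : ℕ) (hr : 1 ≤ r) :
    Q x r (m + 1) ((m + 2) * r - 1) = ∑ i ∈ Finset.range ((m + 1) * r), Q x r m i := by
  obtain ⟨q, rfl⟩ : ∃ q, r = q + 1 := ⟨r - 1, by omega⟩
  have e : (m + 2) * (q + 1) - 1 = (m + 2) * q + (m + 1) := by
    have : (m + 2) * (q + 1) = (m + 2) * q + (m + 2) := by ring
    omega
  rw [Q_rec x (one_sub_ne hx) (q + 1) m _ (by rw [e]; ring_nf; omega), e]
  have h1 : ((m + 2) * q + (m + 1)) / (m + 2) = q := by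
    rw [Nat.mul_add_div (by omega), Nat.div_eq_of_lt (by omega), add_zero]
  have h2 : ((m + 2) * q + (m + 1)) % (m + 2) = m + 1 := by
    rw [Nat.mul_add_mod, Nat.mod_eq_of_lt (by omega)]
  have hs : sI m ((m + 2) * q + (m + 1)) = (m + 1) * (q + 1) := by
    unfold sI; rw [h1, h2]; ring
  have ht : tI m ((m + 2) * q + (m + 1)) = (m + 1) * (q + 1) := by
    unfold tI; rw [hs, h2]; simp
  rw [hs, ht]
  simp [R]

lemma Q_tot_ne {x : ℂ} (hx : 0 < x.im) (r m : ℕ) (hr : 1 ≤ r) :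
    ∑ i ∈ Finset.range ((m + 1) * r), Q x r m i ≠ 0 := by
  induction m with
  | zero =>
    simp only [Q_zero]
    simp
    omega
  | succ m ih =>
    intro h
    have := sum_zero hx (Q_W hx r (m + 1)) _ (by simp) h ((m + 2) * r - 1)
      (by
        have : 0 < (m + 2) * r := by positivity
        simp; omega)
    rw [Q_last hx r m hr] at this
    exact ih this

lemma Q_last_ne {x : ℂ} (hx : 0 < x.im) (r m : ℕ) (hr : 1 ≤ r) :
    Q x r (m + 1) ((m + 2) * r - 1) ≠ 0 := by
  rw [Q_last hx r m hr]
  exact Q_tot_ne hx r m hr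

lemma Q_one_ne {x : ℂ} (hx : 0 < x.im) (r m : ℕ) (hr : 1 ≤ r) :
    Q x r (m + 1) 1 ≠ 0 := by
  have h0 : 0 < (m + 1) * r := by positivity
  rw [Q_rec x (one_sub_ne hx) r m 1 (by nlinarith)]
  have h2 : 1 % (m + 2) = 1 := Nat.mod_eq_of_lt (by omega)
  have hs : sI m 1 = 1 := by
    unfold sI
    rw [h2, Nat.div_eq_of_lt (by omega)]
    ring
  have ht : tI m 1 = 1 := by
    unfold tI
    rw [hs, h2]
    simp
  rw [hs, ht]
  intro h
  have hP := P_blocks (Q_W hx r m) (a := 0) (b := 1) (c := 1) le_rfl le_rfl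
  have htot := Q_tot_ne hx r m hr
  rw [← Finset.sum_range_add_sum_Ico _ (show 1 ≤ (m + 1) * r from h0)] at htot
  rw [← Finset.range_eq_Ico] at hP
  unfold R at h
  generalize (∑ i ∈ Finset.range 1, Q x r m i) = A at *
  generalize (∑ i ∈ Finset.Ico 1 ((m + 1) * r), Q x r m i) = E at *
  have hA : A = - (x * E) := by linear_combination h
  have h1 := hP.1
  rw [hA] at h1
  have e : (-(x * E) * (starRingEnd ℂ) E).im = - (x.im * Complex.normSq E) := by
    simp only [Complex.normSq_apply, Complex.mul_im, Complex.mul_re, Complex.neg_re,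
      Complex.neg_im, Complex.conj_re, Complex.conj_im]
    ring
  rw [e] at h1
  have h3 : Complex.normSq E = 0 := by
    have := Complex.normSq_nonneg E
    nlinarith
  have h4 : E = 0 := Complex.normSq_eq_zero.mp h3
  apply htot
  rw [hA, h4]
  simp

lemma Q_p (x : ℂ) (r n : ℕ) : Q x r n 0 = G n r ((r - 1) * x) x := by
  have := phi_pow x r 0 n
  simpa [Q, QP, Y] using this

lemma Q_q (x : ℂ) (r n : ℕ) (hr : 1 ≤ r) : Q x r n ((n + 1) * (r - 1)) = G n r (r - 1) x := by
  have := phi_pow x r (((r - 1 : ℕ) : ℂ) * (1 - x)) n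
  unfold Q
  rw [Nat.mul_div_cancel_left _ (by omega), Nat.mul_mod_right]
  simp only [QP, if_true, Y]
  rw [this]
  congr 1
  push_cast [hr]
  ring

lemma G_one (ρ w x : ℂ) : G 1 ρ w x = w := by
  simp [G, wt]

lemma rows_p (m r : ℕ) : sI m 0 = 0 ∧ tI m 0 = 1 := by
  simp [sI, tI]

lemma rows_q (m k : ℕ) : sI m ((m + 2) * k) = (m + 1) * k ∧ tI m ((m + 2) * k) = (m + 1) * k + 1 := by
  have hs : sI m ((m + 2) * k) = (m + 1) * k := by
    unfold sI
    rw [Nat.mul_div_cancel_left _ (by omega), Nat.mul_mod_right, add_zero]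
  refine ⟨hs, ?_⟩
  unfold tI
  rw [hs, Nat.mul_mod_right]
  simp

lemma b_ne {x : ℂ} (hx : 0 < x.im) (r n : ℕ) (hn : 1 ≤ n) (hr : 2 ≤ r) :
    G n r ((r - 1) * x) x ≠ G n r (r - 1) x := by
  obtain ⟨m, rfl⟩ : ∃ m, n = m + 1 := ⟨n - 1, by omega⟩
  rcases m with _ | m
  · rw [zero_add, G_one, G_one]
    intro h
    have h1 : ((r : ℂ) - 1) * (1 - x) = 0 := by linear_combination -h
    rcases mul_eq_zero.mp h1 with h2 | h2
    · have : (r : ℂ) = 1 := by linear_combination h2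
      have : r = 1 := by exact_mod_cast this
      omega
    · exact one_sub_ne hx h2
  · intro h
    obtain ⟨k, rfl⟩ : ∃ k, r = k + 2 := ⟨r - 2, by omega⟩
    have hk : (m + 1 + 1) * (k + 2) = (m + 1 + 1) * (k + 1) + (m + 2) := by ring
    have hk' : (m + 1 + 1) * (k + 1) = (m + 2) * k + m + 2 := by ring
    rw [← Q_p, ← Q_q x (k + 2) _ (by omega)] at h
    have e1 := Q_rec x (one_sub_ne hx) (k + 2) (m + 1) 0 (by positivity)
    have e2 := Q_rec x (one_sub_ne hx) (k + 2) (m + 1) ((m + 1 + 2) * (k + 2 - 1))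
      (by apply Nat.mul_lt_mul_of_pos_left <;> omega)
    have rq := rows_q (m + 1) (k + 2 - 1)
    have rp := rows_p (m + 1) 0
    rw [rq.1, rq.2] at e2
    rw [rp.1, rp.2] at e1
    simp only [show k + 2 - 1 = k + 1 by omega] at *
    have key := (rows (Q_W hx (k + 2) (m + 1)) (s := 0) (t := 1) (s' := (m + 1 + 1) * (k + 1))
      (t' := (m + 1 + 1) * (k + 1) + 1) (by omega) (by omega) (by omega) (by omega)).1
    rw [← e1, ← e2] at key
    change Q x (k + 2) (m + 1 + 1) 0 = Q x (k + 2) (m + 1 + 1) ((m + 1 + 2) * (k + 1)) at h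
    rw [← h, Complex.mul_conj, Complex.ofReal_im] at key
    have h0 : ∑ i ∈ Finset.Ico 1 ((m + 1 + 1) * (k + 1)), Q x (k + 2) (m + 1) i = 0 := by
      apply Complex.normSq_eq_zero.mp
      have := Complex.normSq_nonneg (∑ i ∈ Finset.Ico 1 ((m + 1 + 1) * (k + 1)), Q x (k + 2) (m + 1) i)
      nlinarith
    exact Q_one_ne hx (k + 2) m (by omega) (sum_zero hx (Q_W hx (k + 2) (m + 1)) _
      (by intro i hi; rw [Finset.mem_Ico] at hi; omega) h0 1 (by rw [Finset.mem_Ico]; omega))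

lemma a_ne {x : ℂ} (hx : 0 < x.im) (r n : ℕ) (hn : 2 ≤ n) (hr : 1 ≤ r) :
    G n r ((r - 1) * x) x ≠ x * G n r (r - 1) x := by
  obtain ⟨m, rfl⟩ : ∃ m, n = m + 2 := ⟨n - 2, by omega⟩
  obtain ⟨k, rfl⟩ : ∃ k, r = k + 1 := ⟨r - 1, by omega⟩
  intro h
  have hx0 : x ≠ 0 := by rintro rfl; simp at hx
  have hk : (m + 1 + 1) * (k + 1) = (m + 1 + 1) * k + (m + 2) := by ring
  rw [← Q_p, ← Q_q x (k + 1) _ (by omega)] at h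
  have e1 := Q_rec x (one_sub_ne hx) (k + 1) (m + 1) 0 (by positivity)
  have e2 := Q_rec x (one_sub_ne hx) (k + 1) (m + 1) ((m + 1 + 2) * (k + 1 - 1))
    (by apply Nat.mul_lt_mul_of_pos_left <;> omega)
  have rq := rows_q (m + 1) (k + 1 - 1)
  have rp := rows_p (m + 1) 0
  rw [rq.1, rq.2] at e2
  rw [rp.1, rp.2] at e1
  simp only [show k + 1 - 1 = k by omega] at *
  change Q x (k + 1) (m + 1 + 1) 0 = x * Q x (k + 1) (m + 1 + 1) ((m + 1 + 2) * k) at h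
  have h0 : ∑ i ∈ Finset.Ico ((m + 1 + 1) * k + 1) ((m + 1 + 1) * (k + 1)), Q x (k + 1) (m + 1) i = 0 := by
    rcases Nat.eq_zero_or_pos k with rfl | hkp
    · simp only [mul_zero, zero_add] at *
      rw [e1] at h
      have h1 : (1 - x) * (x * ∑ i ∈ Finset.Ico 1 ((m + 1 + 1) * 1), Q x 1 (m + 1) i) = 0 := by
        simp only [R, Finset.range_zero, Finset.sum_empty, zero_add] at h
        linear_combination h
      rcases mul_eq_zero.mp h1 with h2 | h2
      · exact absurd h2 (one_sub_ne hx)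
      · exact (mul_eq_zero.mp h2).resolve_left hx0
    · have hge : (m + 1 + 1) * k ≥ 1 := Nat.mul_pos (by omega) hkp
      have key := (rows (Q_W hx (k + 1) (m + 1)) (s := 0) (t := 1) (s' := (m + 1 + 1) * k)
        (t' := (m + 1 + 1) * k + 1) (by omega) (by omega) (by omega) (by omega)).2
      rw [← e1, ← e2, ← h, Complex.mul_conj, Complex.ofReal_im] at key
      have h1 : Complex.normSq (∑ i ∈ Finset.Ico 0 0, Q x (k + 1) (m + 1) i +
          x * ∑ i ∈ Finset.Ico ((m + 1 + 1) * k + 1) ((m + 1 + 1) * (k + 1)), Q x (k + 1) (m + 1) i) = 0 := by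
        have := Complex.normSq_nonneg (∑ i ∈ Finset.Ico 0 0, Q x (k + 1) (m + 1) i +
          x * ∑ i ∈ Finset.Ico ((m + 1 + 1) * k + 1) ((m + 1 + 1) * (k + 1)), Q x (k + 1) (m + 1) i)
        nlinarith
      have h2 := Complex.normSq_eq_zero.mp h1
      rw [Finset.Ico_self, Finset.sum_empty, zero_add] at h2
      exact (mul_eq_zero.mp h2).resolve_left hx0
  exact Q_last_ne hx (k + 1) m (by omega) (sum_zero hx (Q_W hx (k + 1) (m + 1)) _
    (by intro i hi; rw [Finset.mem_Ico] at hi; omega) h0 ((m + 2) * (k + 1) - 1)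
    (by
      have : (m + 2) * (k + 1) = (m + 1 + 1) * k + (m + 2) := by ring
      rw [Finset.mem_Ico]; omega))

lemma realRooted_of (p : ℝ[X]) (h : ∀ z : ℂ, 0 < z.im → (toC p).eval z ≠ 0) : RealRooted p := by
  right
  intro z hz
  rcases lt_trichotomy z.im 0 with h1 | h1 | h1
  · exfalso
    apply h ((starRingEnd ℂ) z) (by simpa using h1)
    have h2 : (toC p).eval ((starRingEnd ℂ) z) = (starRingEnd ℂ) ((toC p).eval z) := by
      unfold toC
      rw [Polynomial.eval_map, Polynomial.eval_map, Polynomial.hom_eval₂]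
      congr 1
      ext t
      simp
    rw [h2, hz, map_zero]
  · exact h1
  · exact absurd hz (h z h1)

lemma toC_reflect (p : ℝ[X]) (N : ℕ) (hp : p.natDegree ≤ N) (h : Polynomial.reflect N p = p)
    (z : ℂ) (hz : z ≠ 0) : z ^ N * (toC p).eval z⁻¹ = (toC p).eval z := by
  letI := invertibleOfNonzero hz
  have := Polynomial.eval₂_reflect_mul_pow (algebraMap ℝ ℂ) z N p hp
  rw [h, invOf_eq_inv] at this
  unfold toC
  rw [Polynomial.eval_map, Polynomial.eval_map, ← this]
  ring

end Stmt17Aux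

open Stmt17Aux in
/-- for all positive integers `n` and `r`, both polynomials in the
`I_n`-decomposition `(a, b)` of the colored derangement polynomial `d_{n,r}` are
real-rooted. -/
theorem stmt17 (n r : ℕ) (hn : 1 ≤ n) (hr : 1 ≤ r) (a b : ℝ[X])
    (hab : coloredDerangement n r = a + X * b)
    (ha : a.degree ≤ (n : ℕ)) (hb : b.degree < (n : ℕ))
    (hra : Polynomial.reflect n a = a) (hrb : Polynomial.reflect (n - 1) b = b) :
    RealRooted a ∧ RealRooted b := by
  have hN : a.natDegree ≤ n := Polynomial.natDegree_le_of_degree_le ha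
  have hN' : b.natDegree ≤ n - 1 := by
    rcases eq_or_ne b 0 with rfl | h0
    · simp
    · have := (Polynomial.natDegree_lt_iff_degree_lt h0).mpr hb
      omega
  have hp : ∀ z : ℂ, (toC a).eval z + z * (toC b).eval z = G n r ((r - 1) * z) z := by
    intro z
    rw [← coloredDerangement_eval n r hr, hab]
    simp [toC]
  have hq : ∀ z : ℂ, z ≠ 0 → (toC a).eval z + (toC b).eval z = G n r (r - 1) z := by
    intro z hz
    rw [← G_flip n r (r - 1) z hz, ← hp z⁻¹, mul_add, toC_reflect a n hN hra z hz,
      ← toC_reflect b (n - 1) hN' hrb z hz]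
    obtain ⟨m, rfl⟩ : ∃ m, n = m + 1 := ⟨n - 1, by omega⟩
    rw [Nat.add_sub_cancel, pow_succ]
    field_simp
  have ne0 : ∀ z : ℂ, 0 < z.im → z ≠ 0 := by rintro z hz rfl; simp at hz
  constructor
  · rcases Nat.lt_or_ge n 2 with h2 | h2
    · left
      obtain rfl : n = 1 := by omega
      have h0 := hp 0
      rw [G_one, mul_zero, zero_mul, add_zero] at h0
      have h0' : a.coeff 0 = 0 := by
        unfold toC at h0
        rw [← Polynomial.coeff_zero_eq_eval_zero, Polynomial.coeff_map] at h0
        simpa using h0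
      have h1' : a.coeff 1 = 0 := by
        rw [← hra, Polynomial.coeff_reflect]
        simpa [Polynomial.revAt_le] using h0'
      ext i
      rcases i with _ | _ | i
      · simpa using h0'
      · simpa using h1'
      · rw [Polynomial.coeff_eq_zero_of_natDegree_lt (by omega)]
        simp
    · refine realRooted_of a ?_
      intro z hz h0
      have e1 := hp z
      have e2 := hq z (ne0 z hz)
      apply a_ne hz r n h2 hr
      rw [← e1, ← e2, h0]
      ring
  · rcases Nat.lt_or_ge r 2 with h2 | h2
    · left
      obtain rfl : r = 1 := by omega
      have hz : ∀ z : ℂ, 0 < z.im → (toC b).eval z = 0 := by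
        intro z hz
        have e1 := hp z
        have e2 := hq z (ne0 z hz)
        have e3 : (1 - z) * (toC b).eval z = 0 := by
          simp only [Nat.cast_one, sub_self, zero_mul] at e1 e2
          linear_combination e2 - e1
        exact (mul_eq_zero.mp e3).resolve_left (one_sub_ne hz)
      have hb0 : toC b = 0 := by
        apply Polynomial.eq_zero_of_infinite_isRoot
        refine Set.infinite_of_injective_forall_mem (f := fun k : ℕ => ((k : ℂ) + Complex.I)) ?_ ?_
        · intro i j hij
          simpa using hij
        · intro k
          exact hz _ (by simp)
      exact (Polynomial.map_eq_zero _).mp hb0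
    · refine realRooted_of b ?_
      intro z hz h0
      have e1 := hp z
      have e2 := hq z (ne0 z hz)
      apply b_ne hz r n hn h2
      rw [← e1, ← e2, h0]
      ring
end

section
/- Let m, d, and k be nonnegative integers, and let B_{d,m} denote the set of all nonnegative linear combinations of the polynomials x^j·(mx+1)^{d−j} for j = 0, 1, …, d. Then for every f ∈ B_{d,m}, the polynomial T_k(f) lies in B_{d,m} (equivalently, φ_k(B_{d,m}) ⊆ B_{d,m}, where φ_k := T_k/k!). -/
open Polynomial
open scoped Classical

/-- all iterated forward differences are nonnegative -/
def AbsMon (g : ℕ → ℝ) : Prop := ∀ k n : ℕ, 0 ≤ (fwdDiff (1 : ℕ))^[k] g n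

lemma AbsMon.diff {g : ℕ → ℝ} (h : AbsMon g) : AbsMon (fwdDiff (1 : ℕ) g) := by
  intro k n
  have := h (k + 1) n
  rwa [Function.iterate_succ_apply] at this

lemma fwdDiff_iter_add_fun (k : ℕ) (f g : ℕ → ℝ) :
    (fwdDiff (1 : ℕ))^[k] (f + g) = (fwdDiff (1 : ℕ))^[k] f + (fwdDiff (1 : ℕ))^[k] g := by
  induction k generalizing f g with
  | zero => rfl
  | succ k ih => rw [Function.iterate_succ_apply, fwdDiff_add, ih]; rfl

lemma AbsMon.add {f g : ℕ → ℝ} (hf : AbsMon f) (hg : AbsMon g) : AbsMon (f + g) := by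
  intro k n
  rw [fwdDiff_iter_add_fun]
  exact add_nonneg (hf k n) (hg k n)

lemma AbsMon.shift {f : ℕ → ℝ} (hf : AbsMon f) : AbsMon (f + fwdDiff (1 : ℕ) f) :=
  hf.add hf.diff

lemma AbsMon.mul {f g : ℕ → ℝ} (hf : AbsMon f) (hg : AbsMon g) : AbsMon (f * g) := by
  intro k
  induction k generalizing f g with
  | zero => intro n; exact mul_nonneg (hf 0 n) (hg 0 n)
  | succ k ih =>
    intro n
    have e : fwdDiff (1 : ℕ) (f * g)
        = (f + fwdDiff (1 : ℕ) f) * fwdDiff (1 : ℕ) g + fwdDiff (1 : ℕ) f * g := by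
      funext x
      simp only [fwdDiff, Pi.mul_apply, Pi.add_apply]
      ring
    rw [Function.iterate_succ_apply, e, fwdDiff_iter_add_fun]
    exact add_nonneg (ih hf.shift hg.diff n) (ih hf.diff hg n)

lemma absMon_const (c : ℝ) (hc : 0 ≤ c) : AbsMon (fun _ => c) := by
  intro k n
  cases k with
  | zero => exact hc
  | succ k =>
    have h0 : fwdDiff (1 : ℕ) (fun _ : ℕ => c) = fun _ => (0 : ℝ) := by
      funext x; simp [fwdDiff]
    have h1 : ∀ k : ℕ, (fwdDiff (1 : ℕ))^[k] (fun _ : ℕ => (0 : ℝ)) = fun _ => 0 := by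
      intro k
      induction k with
      | zero => rfl
      | succ k ih =>
        rw [Function.iterate_succ_apply]
        have : fwdDiff (1 : ℕ) (fun _ : ℕ => (0 : ℝ)) = fun _ => (0 : ℝ) := by
          funext x; simp [fwdDiff]
        rw [this, ih]
    rw [Function.iterate_succ_apply, h0, h1]

lemma absMon_id : AbsMon (fun i => (i : ℝ)) := by
  intro k n
  cases k with
  | zero => simp
  | succ k =>
    have h0 : fwdDiff (1 : ℕ) (fun i : ℕ => (i : ℝ)) = fun _ => (1 : ℝ) := by
      funext x; simp [fwdDiff]
    rw [Function.iterate_succ_apply, h0]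
    exact absMon_const 1 zero_le_one k n

lemma AbsMon.pow {f : ℕ → ℝ} (hf : AbsMon f) (n : ℕ) : AbsMon (f ^ n) := by
  induction n with
  | zero => exact absMon_const 1 zero_le_one
  | succ n ih => rw [pow_succ]; exact ih.mul hf

lemma diff_sum_nonneg (k l j : ℕ) :
    0 ≤ ∑ i ∈ Finset.range (k + 1),
      ((-1 : ℝ) ^ (k - i) * (k.choose i : ℝ)) * ((i : ℝ) ^ l * ((i : ℝ) + 1) ^ j) := by
  have h := ((absMon_id.pow l).mul ((absMon_id.add (absMon_const 1 zero_le_one)).pow j)) k 0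
  rw [fwdDiff_iter_eq_sum_shift] at h
  simpa using h

lemma coneBm_zero (d m : ℕ) : (0 : ℝ[X]) ∈ coneBm d m :=
  ⟨fun _ => 0, fun _ => le_rfl, by simp⟩

lemma coneBm_add {d m : ℕ} {p q : ℝ[X]} (hp : p ∈ coneBm d m) (hq : q ∈ coneBm d m) :
    p + q ∈ coneBm d m := by
  obtain ⟨a, ha, rfl⟩ := hp
  obtain ⟨b, hb, rfl⟩ := hq
  exact ⟨fun i => a i + b i, fun i => add_nonneg (ha i) (hb i), by
    simp only [add_smul, Finset.sum_add_distrib]⟩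

lemma coneBm_smul {d m : ℕ} {p : ℝ[X]} {c : ℝ} (hc : 0 ≤ c) (hp : p ∈ coneBm d m) :
    c • p ∈ coneBm d m := by
  obtain ⟨a, ha, rfl⟩ := hp
  exact ⟨fun i => c * a i, fun i => mul_nonneg hc (ha i), by
    simp only [mul_smul, Finset.smul_sum]⟩

lemma coneBm_sum {d m : ℕ} (s : Finset ℕ) (p : ℕ → ℝ[X]) (hp : ∀ i ∈ s, p i ∈ coneBm d m) :
    ∑ i ∈ s, p i ∈ coneBm d m :=
  Finset.sum_induction p (· ∈ coneBm d m) (fun _ _ => coneBm_add) (coneBm_zero d m) hp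

lemma coneBm_basis {d m j : ℕ} (hj : j ≤ d) :
    X ^ j * (Polynomial.C (m : ℝ) * X + 1) ^ (d - j) ∈ coneBm d m := by
  refine ⟨fun i => if i = j then 1 else 0, fun i => by dsimp only; split_ifs <;> simp, ?_⟩
  simp [ite_smul, Nat.lt_succ_of_le hj]

lemma Tk_basis (d m k j : ℕ) :
    Tk k (X ^ j * (Polynomial.C (m : ℝ) * X + 1) ^ (d - j)) =
      ∑ l ∈ Finset.range (d - j + 1),
        ((∑ i ∈ Finset.range (k + 1),
          ((-1 : ℝ) ^ (k - i) * (k.choose i : ℝ)) * ((i : ℝ) ^ l * ((i : ℝ) + 1) ^ j))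
          * ((m : ℝ) ^ l * ((d - j).choose l : ℝ))) •
        (X ^ (j + l) * (Polynomial.C (m : ℝ) * X + 1) ^ (d - (j + l))) := by
  simp only [Finset.sum_mul, Finset.sum_smul]
  rw [Finset.sum_comm]
  unfold Tk
  refine Finset.sum_congr rfl fun i _ => ?_
  have e : (X ^ j * (Polynomial.C (m : ℝ) * X + 1) ^ (d - j)).comp (Polynomial.C ((i : ℝ) + 1) * X)
      = Polynomial.C (((i : ℝ) + 1) ^ j) * X ^ j *
        (Polynomial.C ((i : ℝ) * m) * X + (Polynomial.C (m : ℝ) * X + 1)) ^ (d - j) := by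
    simp only [mul_comp, pow_comp, X_comp, add_comp, C_comp, one_comp, mul_pow, map_mul, map_pow,
      map_add, map_one]
    congr 2
    ring
  rw [e, add_pow (Polynomial.C ((i : ℝ) * m) * X), Finset.mul_sum, Finset.smul_sum]
  refine Finset.sum_congr rfl fun l _ => ?_
  rw [← Nat.sub_sub]
  simp only [smul_eq_C_mul, map_mul, map_pow, mul_pow, pow_add, map_natCast]
  ring

/-- the cone `B_{d,m}` spanned by the polynomials `x^j (mx+1)^{d-j}`,
`0 ≤ j ≤ d`, is preserved by `T_k` (equivalently by `φ_k = T_k/k!`). -/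
theorem stmt19 (d m k : ℕ) (f : ℝ[X]) (hf : f ∈ coneBm d m) :
    Tk k f ∈ coneBm d m := by
  obtain ⟨c, hc, rfl⟩ := hf
  have e : Tk k (∑ j ∈ Finset.range (d + 1),
      c j • (X ^ j * (Polynomial.C (m : ℝ) * X + 1) ^ (d - j))) =
      ∑ j ∈ Finset.range (d + 1),
        c j • Tk k (X ^ j * (Polynomial.C (m : ℝ) * X + 1) ^ (d - j)) := by
    unfold Tk
    simp only [Finset.smul_sum]
    rw [Finset.sum_comm]
    refine Finset.sum_congr rfl fun i _ => ?_
    rw [Polynomial.sum_comp, Finset.smul_sum]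
    refine Finset.sum_congr rfl fun j _ => ?_
    rw [smul_comp, smul_comm]
  rw [e]
  refine coneBm_sum _ _ fun j hj => coneBm_smul (hc j) ?_
  rw [Tk_basis]
  have hj' := Finset.mem_range.1 hj
  refine coneBm_sum _ _ fun l hl => coneBm_smul ?_ (coneBm_basis ?_)
  · exact mul_nonneg (diff_sum_nonneg k l j) (by positivity)
  · have := Finset.mem_range.1 hl
    omega
end
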